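/- Let I ⊆ A = k[x_1,…,x_n] be a monomial ideal with minimal monomial generators m_1,…,m_t, each of degree at least 2, satisfying the minimal Taylor resolution condition, and assume gcd(m_1,…,m_t) is a non-unit. Then the Poincaré series of R = A/I satisfies (Σ_{i≥0} dim_k(Tor_i^R(k,k)) z^i)·(1 − Σ_{i=1}^{t} C(t,i) z^{i+1}) = (1+z)^n as formal power series; that is, P_k^R(z) = (1+z)^n/(1 − Σ_{i=1}^{t} C(t,i) z^{i+1}). -/

import Mathlib

open CategoryTheory MvPolynomial

/-- `Tor_i^R(R/J, R/J)` as an object of `ModuleCat R`; for `J` the maximal ideal of a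
local `k`-algebra `R` this is `Tor_i^R(k, k)`. -/
noncomputable def TorResidue (R : Type) [CommRing R] (J : Ideal R) (i : ℕ) : ModuleCat R :=
  ((Tor (ModuleCat R) i).obj (ModuleCat.of R (R ⧸ J))).obj (ModuleCat.of R (R ⧸ J))

/-- `Tor_i^R(R/J, R/J)` regarded as a `k`-vector space via `algebraMap k R`. -/
noncomputable def TorVS (k : Type) [Field k] (R : Type) [CommRing R] [Algebra k R]
    (J : Ideal R) (i : ℕ) : Type :=
  TorResidue R J i

noncomputable instance (k : Type) [Field k] (R : Type) [CommRing R] [Algebra k R]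
    (J : Ideal R) (i : ℕ) : AddCommGroup (TorVS k R J i) :=
  inferInstanceAs (AddCommGroup (TorResidue R J i))

noncomputable instance (k : Type) [Field k] (R : Type) [CommRing R] [Algebra k R]
    (J : Ideal R) (i : ℕ) : Module k (TorVS k R J i) :=
  Module.compHom (TorResidue R J i) (algebraMap k R)

/-- The maximal ideal of `A/I`: the image of `𝔪_A = (x_1, …, x_n)`. -/
noncomputable def resMax (k : Type) [Field k] (n : ℕ) (I : Ideal (MvPolynomial (Fin n) k)) :
    Ideal (MvPolynomial (Fin n) k ⧸ I) :=
  Ideal.map (Ideal.Quotient.mk I) (Ideal.span (Set.range (X : Fin n → MvPolynomial (Fin n) k)))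

/-- Monomials (given by their exponent vectors) satisfy the minimal Taylor resolution
condition if for every subset `S` of indices and every `j ∈ S`, the lcm of the monomials
indexed by `S` differs from the lcm of the monomials indexed by `S \ {j}`. -/
def MinimalTaylor {n t : ℕ} (m : Fin t → (Fin n →₀ ℕ)) : Prop :=
  ∀ S : Finset (Fin t), ∀ j ∈ S, S.sup m ≠ (S.erase j).sup m

section KoszulOperator

variable {A M : Type} [CommRing A] [AddCommGroup M] [Module A M]

/-- The Koszul differential of a functional, acting on the whole exterior algebra. -/
noncomputable def koszulD (φ : Module.Dual A M) :
    ExteriorAlgebra A M →ₗ[A] ExteriorAlgebra A M :=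
  CliffordAlgebra.contractLeft (Q := (0 : QuadraticForm A M)) φ

variable (φ : Module.Dual A M)

lemma koszulD_ι_mul (v : M) (b : ExteriorAlgebra A M) :
    koszulD φ (ExteriorAlgebra.ι A v * b) = φ v • b - ExteriorAlgebra.ι A v * koszulD φ b :=
  CliffordAlgebra.contractLeft_ι_mul _ _ _

lemma koszulD_algebraMap (c : A) :
    koszulD φ (algebraMap A (ExteriorAlgebra A M) c) = 0 :=
  CliffordAlgebra.contractLeft_algebraMap _ _ _

lemma koszulD_one : koszulD φ (1 : ExteriorAlgebra A M) = 0 :=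
  CliffordAlgebra.contractLeft_one _ _

lemma koszulD_koszulD (x : ExteriorAlgebra A M) : koszulD φ (koszulD φ x) = 0 :=
  CliffordAlgebra.contractLeft_contractLeft _ _

lemma koszulD_comm (ψ : Module.Dual A M) (x : ExteriorAlgebra A M) :
    koszulD φ (koszulD ψ x) = -koszulD ψ (koszulD φ x) :=
  CliffordAlgebra.contractLeft_comm _ _ _

@[elab_as_elim]
lemma exteriorAlgebra_left_induction {P : ExteriorAlgebra A M → Prop}
    (algebraMap : ∀ r : A, P (algebraMap A _ r))
    (add : ∀ x y, P x → P y → P (x + y))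
    (ι_mul : ∀ x m, P x → P (ExteriorAlgebra.ι A m * x)) (x : ExteriorAlgebra A M) : P x :=
  CliffordAlgebra.left_induction _ algebraMap add ι_mul x

lemma koszulD_mul_cycle {w : ExteriorAlgebra A M} (hw : koszulD φ w = 0)
    (a : ExteriorAlgebra A M) : koszulD φ (a * w) = koszulD φ a * w := by
  induction a using exteriorAlgebra_left_induction with
  | algebraMap r => simp [koszulD_algebraMap, ← Algebra.smul_def, hw]
  | add x y hx hy => simp [add_mul, hx, hy]
  | ι_mul x v hx => simp only [mul_assoc, koszulD_ι_mul, hx, sub_mul, smul_mul_assoc]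

lemma map_mem_smul_top {N N' : Type} [AddCommGroup N] [AddCommGroup N'] [Module A N] [Module A N']
    (f : N →ₗ[A] N') {I : Ideal A} {x : N} (hx : x ∈ I • (⊤ : Submodule A N)) :
    f x ∈ I • (⊤ : Submodule A N') := by
  have := Submodule.mem_map_of_mem (f := f) hx
  rw [Submodule.map_smul''] at this
  exact Submodule.smul_mono le_rfl le_top this

lemma mul_mem_smul_top {B : Type} [Ring B] [Algebra A B] {I : Ideal A} (a : B) {x : B}
    (hx : x ∈ I • (⊤ : Submodule A B)) : a * x ∈ I • (⊤ : Submodule A B) :=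
  map_mem_smul_top (LinearMap.mulLeft A a) hx

lemma mem_smul_top_iff_repr {N B : Type} [AddCommGroup N] [Module A N] (b : Module.Basis B A N)
    {I : Ideal A} {x : N} : x ∈ I • (⊤ : Submodule A N) ↔ ∀ i, b.repr x i ∈ I := by
  constructor
  · intro hx i
    have := map_mem_smul_top (b.coord i) hx
    simpa using this
  · intro h
    rw [← b.linearCombination_repr x, Finsupp.linearCombination_apply]
    exact Submodule.sum_mem _ fun i _ => Submodule.smul_mem_smul (h i) trivial

/-- Multiplication by a value of `φ` is null-homotopic on cycles modulo `I`. -/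
lemma smul_cycle_boundary {I : Ideal A} {c : A} (hc : c ∈ LinearMap.range φ)
    {z : ExteriorAlgebra A M} (hz : koszulD φ z ∈ I • (⊤ : Submodule A (ExteriorAlgebra A M))) :
    ∃ b, c • z - koszulD φ b ∈ I • (⊤ : Submodule A (ExteriorAlgebra A M)) := by
  obtain ⟨y, rfl⟩ := hc
  refine ⟨ExteriorAlgebra.ι A y * z, ?_⟩
  rw [koszulD_ι_mul, sub_sub_cancel]
  exact mul_mem_smul_top _ hz

/-- The classes of the `z s`, `s ∈ T`, form a basis of the homology of `d` modulo `N`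
over the residue ring of `𝔪`. -/
structure IsHomologyBasis {K σ : Type} [AddCommGroup K] [Module A K] (d : K →ₗ[A] K)
    (N : Submodule A K) (𝔪 : Ideal A) (T : Finset σ) (z : σ → K) : Prop where
  cycle : ∀ s ∈ T, d (z s) ∈ N
  span : ∀ a, d a ∈ N → ∃ (b : K) (c : σ → A), a - d b - ∑ s ∈ T, c s • z s ∈ N
  indep : ∀ (b : K) (c : σ → A), ∑ s ∈ T, c s • z s - d b ∈ N → ∀ s ∈ T, c s ∈ 𝔪

/-- Homology of `K / N` from that of `K / N'` and `K / N''`, where `N = N' + μ K` and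
`N'' = (N' : μ)`, when multiplication by `μ` is zero in homology. -/
lemma IsHomologyBasis.powerset_insert {K σ : Type} [AddCommGroup K] [Module A K] [DecidableEq σ]
    {d : K →ₗ[A] K} (hdd : ∀ x, d (d x) = 0) {N N' N'' : Submodule A K} {𝔪 : Ideal A} {μ : A}
    (hdN' : ∀ x ∈ N', d x ∈ N')
    (hN : ∀ x, x ∈ N ↔ ∃ y, x - μ • y ∈ N') (hcolon : ∀ y, μ • y ∈ N' ↔ y ∈ N'')
    (hnull : ∀ c ∈ 𝔪, ∀ z, d z ∈ N → ∃ b, c • z - d b ∈ N)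
    {a : σ} {T : Finset σ} (ha : a ∉ T) {z z'' : Finset σ → K}
    (h' : IsHomologyBasis d N' 𝔪 T.powerset z) (h'' : IsHomologyBasis d N'' 𝔪 T.powerset z'')
    (hz : ∀ s ∈ T.powerset, d (z (insert a s)) - μ • z'' s ∈ N') :
    IsHomologyBasis d N 𝔪 (insert a T).powerset z := by
  have hle : N' ≤ N := fun x hx => (hN x).2 ⟨0, by simpa using hx⟩
  have hμ : ∀ y, μ • y ∈ N := fun y => (hN _).2 ⟨y, by simp⟩
  have hcyc : ∀ s ∈ T.powerset, d (z (insert a s)) ∈ N := fun s hs =>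
    (hN _).2 ⟨_, hz s hs⟩
  -- a cycle modulo `N''` becomes, after multiplication by `μ`, a boundary modulo `N'`
  have key : ∀ y, d y ∈ N'' → ∃ (b : K) (e : Finset σ → A),
      μ • (y - d b) - d (∑ s ∈ T.powerset, e s • z (insert a s)) ∈ N' := by
    intro y hy
    obtain ⟨b, e, hbe⟩ := h''.span y hy
    refine ⟨b, e, ?_⟩
    have h1 := (hcolon _).2 hbe
    have h2 : ∑ s ∈ T.powerset, e s • (d (z (insert a s)) - μ • z'' s) ∈ N' :=
      Submodule.sum_mem _ fun s hs => Submodule.smul_mem _ _ (hz s hs)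
    convert Submodule.sub_mem _ h1 h2 using 1
    simp only [smul_sub, Finset.sum_sub_distrib, map_sum, map_smul, Finset.smul_sum]
    simp only [smul_comm μ]
    abel
  have hdy : ∀ y, μ • d y ∈ N' → d y ∈ N'' := fun y hy => (hcolon _).1 hy
  refine ⟨?_, ?_, ?_⟩
  · intro s hs
    by_cases has : a ∈ s
    · rw [← Finset.insert_erase has]
      exact hcyc _ (by
        rw [Finset.mem_powerset] at hs ⊢
        exact (Finset.subset_insert_iff).1 hs)
    · refine hle (h'.cycle s ?_)
      rw [Finset.mem_powerset] at hs ⊢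
      exact (Finset.subset_insert_iff_of_notMem has).1 hs
  · intro x hx
    obtain ⟨y, hy⟩ := (hN _).1 hx
    have h1 := hdN' _ hy
    rw [map_sub, hdd, zero_sub, map_smul, neg_mem_iff] at h1
    obtain ⟨b, e, hbe⟩ := key y (hdy _ h1)
    have h2 : d (x - μ • b - ∑ s ∈ T.powerset, e s • z (insert a s)) ∈ N' := by
      convert Submodule.add_mem _ hy hbe using 1
      simp only [map_sub, map_smul, smul_sub]
      abel
    obtain ⟨b', c, hc⟩ := h'.span _ h2
    refine ⟨b', fun s => if a ∈ s then e (s.erase a) else c s, ?_⟩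
    rw [Finset.sum_powerset_insert ha]
    have e1 : ∑ s ∈ T.powerset, (if a ∈ s then e (s.erase a) else c s) • z s =
        ∑ s ∈ T.powerset, c s • z s := Finset.sum_congr rfl fun s hs => by
      rw [if_neg fun h => ha (Finset.mem_powerset.1 hs h)]
    have e2 : ∑ s ∈ T.powerset, (if a ∈ insert a s then e ((insert a s).erase a)
        else c (insert a s)) • z (insert a s) =
        ∑ s ∈ T.powerset, e s • z (insert a s) := Finset.sum_congr rfl fun s hs => by
      rw [if_pos (Finset.mem_insert_self _ _),
        Finset.erase_insert fun h => ha (Finset.mem_powerset.1 hs h)]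
    rw [e1, e2]
    convert Submodule.add_mem _ (hle hc) (hμ b) using 1
    abel
  · intro b c hbc
    rw [Finset.sum_powerset_insert ha] at hbc
    obtain ⟨y, hy⟩ := (hN _).1 hbc
    have hdz : ∑ s ∈ T.powerset, c s • d (z s) ∈ N' :=
      Submodule.sum_mem _ fun s hs => Submodule.smul_mem _ _ (h'.cycle s hs)
    have hcz : ∀ s ∈ T.powerset, c (insert a s) ∈ 𝔪 := by
      apply h''.indep y (fun s => c (insert a s))
      rw [← hcolon]
      have h1 := hdN' _ hy
      have h3 : ∑ s ∈ T.powerset, c (insert a s) •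
          (d (z (insert a s)) - μ • z'' s) ∈ N' :=
        Submodule.sum_mem _ fun s hs => Submodule.smul_mem _ _ (hz s hs)
      convert Submodule.sub_mem _ (Submodule.sub_mem _ h1 hdz) h3 using 1
      simp only [map_sub, map_add, map_sum, map_smul, smul_sub, Finset.sum_sub_distrib,
        Finset.smul_sum, hdd]
      simp only [smul_comm μ]
      abel
    have hcb : ∃ b', ∑ s ∈ T.powerset, c (insert a s) • z (insert a s) - d b' ∈ N := by
      choose! β hβ using fun s hs => hnull _ (hcz s hs) _ (hcyc s hs)
      refine ⟨∑ s ∈ T.powerset, β s, ?_⟩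
      rw [map_sum, ← Finset.sum_sub_distrib]
      exact Submodule.sum_mem _ hβ
    have hcT : ∀ s ∈ T.powerset, c s ∈ 𝔪 := by
      obtain ⟨b', hb'⟩ := hcb
      obtain ⟨y, hy⟩ := (hN _).1 (Submodule.sub_mem _ hbc hb')
      have h1 := hdN' _ hy
      have h3 : μ • d y ∈ N' := by
        convert Submodule.sub_mem _ hdz h1 using 1
        simp only [map_sub, map_add, map_sum, map_smul, hdd]
        abel
      obtain ⟨β, e, hbe⟩ := key y (hdy _ h3)
      refine h'.indep (b - b' + μ • β + ∑ s ∈ T.powerset, e s • z (insert a s)) c ?_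
      convert Submodule.add_mem _ hy hbe using 1
      simp only [map_sub, map_add, map_smul, smul_sub]
      abel
    intro s hs
    by_cases has : a ∈ s
    · rw [← Finset.insert_erase has]
      refine hcz _ ?_
      rw [Finset.mem_powerset] at hs ⊢
      exact (Finset.subset_insert_iff).1 hs
    · refine hcT s ?_
      rw [Finset.mem_powerset] at hs ⊢
      exact (Finset.subset_insert_iff_of_notMem has).1 hs

end KoszulOperator

section KoszulExact

variable {A : Type} [CommRing A] {n : ℕ}

/-- The `j`-th standard generator of the exterior algebra. -/
noncomputable def extGen (A : Type) [CommRing A] {n : ℕ} (j : Fin n) :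
    ExteriorAlgebra A (Fin n → A) :=
  ExteriorAlgebra.ι A (Pi.single j 1)

lemma koszulD_extGen_mul (φ : Module.Dual A (Fin n → A)) (j : Fin n)
    (b : ExteriorAlgebra A (Fin n → A)) :
    koszulD φ (extGen A j * b) = φ (Pi.single j 1) • b - extGen A j * koszulD φ b :=
  koszulD_ι_mul _ _ _

lemma extGen_mul_extGen_mul (i j : Fin n) (b : ExteriorAlgebra A (Fin n → A)) :
    extGen A i * (extGen A j * b) = -(extGen A j * (extGen A i * b)) := by
  rw [← mul_assoc, ← mul_assoc, ← neg_mul]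
  exact congrArg (· * b) (eq_neg_of_add_eq_zero_left (ExteriorAlgebra.ι_add_mul_swap _ _))

lemma ι_eq_sum_extGen (v : Fin n → A) :
    ExteriorAlgebra.ι A v = ∑ j, v j • extGen A j := by
  simp only [extGen, ← map_smul, ← map_sum]
  congr 1
  exact (pi_eq_sum_univ' v)

/-- The projection onto the part of the exterior algebra not involving the `j`-th generator. -/
noncomputable def dropGen (j : Fin n) (b : ExteriorAlgebra A (Fin n → A)) :
    ExteriorAlgebra A (Fin n → A) :=
  b - extGen A j * koszulD (LinearMap.proj j) b

lemma dropGen_extGen_mul (i j : Fin n) (b : ExteriorAlgebra A (Fin n → A)) :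
    dropGen j (extGen A i * b) = if i = j then 0 else extGen A i * dropGen j b := by
  unfold dropGen
  rw [koszulD_extGen_mul]
  split_ifs with h
  · subst h
    have h0 : extGen A i * (extGen A i * koszulD (LinearMap.proj i) b) = 0 := by
      rw [← mul_assoc]
      simp [extGen]
    simp only [LinearMap.proj_apply, Pi.single_eq_same, one_smul, mul_sub] at h0 ⊢
    rw [h0]
    abel
  · simp only [LinearMap.proj_apply, Pi.single_eq_of_ne (Ne.symm h), zero_smul, zero_sub,
      mul_sub, mul_neg]
    rw [extGen_mul_extGen_mul j i]
    abel

lemma exists_algebraMap_of_proj_eq_zero (a : ExteriorAlgebra A (Fin n → A))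
    (ha : ∀ j, koszulD (LinearMap.proj j) a = 0) : ∃ c, a = algebraMap A _ c := by
  have hadd : ∀ (l : List (Fin n)) (x y : ExteriorAlgebra A (Fin n → A)),
      l.foldr dropGen (x + y) = l.foldr dropGen x + l.foldr dropGen y := by
    intro l x y
    induction l with
    | nil => rfl
    | cons j l ih => simp only [List.foldr_cons, ih, dropGen, map_add, mul_add]; abel
  have hsmul : ∀ (l : List (Fin n)) (c : A) (x : ExteriorAlgebra A (Fin n → A)),
      l.foldr dropGen (c • x) = c • l.foldr dropGen x := by
    intro l c x
    induction l with
    | nil => rfl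
    | cons j l ih => simp only [List.foldr_cons, ih, dropGen, map_smul, mul_smul_comm, smul_sub]
  have hgen : ∀ (l : List (Fin n)) (i : Fin n) (x : ExteriorAlgebra A (Fin n → A)),
      l.foldr dropGen (extGen A i * x) =
        if i ∈ l then 0 else extGen A i * l.foldr dropGen x := by
    intro l i x
    induction l with
    | nil => simp
    | cons j l ih =>
      simp only [List.foldr_cons, ih]
      by_cases h : i ∈ l
      · simp [h, dropGen]
      · rw [if_neg h, dropGen_extGen_mul]
        by_cases hij : i = j <;> simp [h, hij]
  have hscal : ∀ (x : ExteriorAlgebra A (Fin n → A)), ∃ c,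
      (List.finRange n).foldr dropGen x = algebraMap A _ c := by
    intro x
    induction x using exteriorAlgebra_left_induction with
    | algebraMap r =>
      refine ⟨r, ?_⟩
      induction List.finRange n with
      | nil => rfl
      | cons j l ih => simp [List.foldr_cons, ih, dropGen, koszulD_algebraMap]
    | add x y hx hy =>
      obtain ⟨c, hc⟩ := hx
      obtain ⟨d, hd⟩ := hy
      exact ⟨c + d, by rw [hadd, hc, hd, map_add]⟩
    | ι_mul x v _ =>
      refine ⟨0, ?_⟩
      rw [ι_eq_sum_extGen, Finset.sum_mul, map_zero]
      have : ∀ s : Finset (Fin n), (List.finRange n).foldr dropGen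
          (∑ j ∈ s, (v j • extGen A j) * x) = 0 := by
        intro s
        induction s using Finset.induction_on with
        | empty =>
          have := hsmul (List.finRange n) 0 0
          simpa using this
        | insert j s hj ih =>
          rw [Finset.sum_insert hj, hadd, ih, smul_mul_assoc, hsmul, hgen]
          simp
      exact this _
  obtain ⟨c, hc⟩ := hscal a
  refine ⟨c, ?_⟩
  rw [← hc]
  induction List.finRange n with
  | nil => rfl
  | cons j l ih => rw [List.foldr_cons, ← ih, dropGen, ha, mul_zero, sub_zero]

variable (k : Type) [Field k]

/-- The functional on `A^n` sending the standard basis to the variables. -/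
noncomputable def varFun (n : ℕ) :
    Module.Dual (MvPolynomial (Fin n) k) (Fin n → MvPolynomial (Fin n) k) :=
  ∑ j, (X j : MvPolynomial (Fin n) k) • LinearMap.proj j

lemma varFun_single (j : Fin n) (c : MvPolynomial (Fin n) k) :
    varFun k n (Pi.single j c) = X j * c := by
  simp [varFun, LinearMap.sum_apply, Pi.single_apply]

lemma koszulD_varFun
    (b : ExteriorAlgebra (MvPolynomial (Fin n) k) (Fin n → MvPolynomial (Fin n) k)) :
    koszulD (varFun k n) b =
      ∑ j, (X j : MvPolynomial (Fin n) k) • koszulD (LinearMap.proj j) b := by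
  simp [koszulD, varFun, LinearMap.sum_apply]

variable {k}

lemma algebraMapInv_koszulD_mem (s : Set (Fin n))
    (b : ExteriorAlgebra (MvPolynomial (Fin n) k) (Fin n → MvPolynomial (Fin n) k))
    (hb : ∀ j ∉ s, koszulD (LinearMap.proj j) b = 0) :
    ExteriorAlgebra.algebraMapInv (koszulD (varFun k n) b) ∈
      Ideal.span (X '' s : Set (MvPolynomial (Fin n) k)) := by
  rw [koszulD_varFun, map_sum]
  refine Submodule.sum_mem _ fun j _ => ?_
  by_cases hj : j ∈ s
  · rw [map_smul, smul_eq_mul]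
    exact Ideal.mul_mem_right _ _ (Ideal.subset_span ⟨j, hj, rfl⟩)
  · rw [hb j hj]
    simp

lemma mem_span_X_of_X_mul_mem (s : Set (Fin n)) {j : Fin n} (hj : j ∉ s)
    {c : MvPolynomial (Fin n) k}
    (h : X j * c ∈ Ideal.span (X '' s : Set (MvPolynomial (Fin n) k))) :
    c ∈ Ideal.span (X '' s : Set (MvPolynomial (Fin n) k)) := by
  rw [mem_ideal_span_X_image] at h ⊢
  intro m hm
  obtain ⟨i, hi, him⟩ := h (Finsupp.single j 1 + m) (by
    rw [mem_support_iff] at hm ⊢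
    rwa [coeff_X_mul])
  refine ⟨i, hi, ?_⟩
  have : i ≠ j := fun h => hj (h ▸ hi)
  simpa [Finsupp.single_apply, this.symm] using him

lemma exists_varFun_eq (s : Set (Fin n)) {c : MvPolynomial (Fin n) k}
    (h : c ∈ Ideal.span (X '' s : Set (MvPolynomial (Fin n) k))) :
    ∃ v : Fin n → MvPolynomial (Fin n) k, (∀ j ∉ s, v j = 0) ∧ varFun k n v = c := by
  induction h using Submodule.span_induction with
  | mem x hx =>
    obtain ⟨i, hi, rfl⟩ := hx
    refine ⟨Pi.single i 1, fun j hj => ?_, by simp [varFun_single]⟩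
    rw [Pi.single_eq_of_ne]
    exact fun h => hj (h ▸ hi)
  | zero => exact ⟨0, by simp, by simp⟩
  | add x y _ _ hx hy =>
    obtain ⟨v, hv, rfl⟩ := hx
    obtain ⟨w, hw, rfl⟩ := hy
    exact ⟨v + w, fun j hj => by simp [hv j hj, hw j hj], by simp⟩
  | smul a x _ hx =>
    obtain ⟨v, hv, rfl⟩ := hx
    exact ⟨a • v, fun j hj => by simp [hv j hj], by simp⟩

lemma range_varFun : LinearMap.range (varFun k n) =
    Ideal.span (Set.range (X : Fin n → MvPolynomial (Fin n) k)) := by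
  ext c
  constructor
  · rintro ⟨v, rfl⟩
    simp only [varFun, LinearMap.sum_apply]
    refine Submodule.sum_mem _ fun j _ => ?_
    exact Ideal.mul_mem_right _ _ (Ideal.subset_span ⟨j, rfl⟩)
  · intro h
    rw [← Set.image_univ] at h
    obtain ⟨v, -, hv⟩ := exists_varFun_eq _ h
    exact ⟨v, hv⟩

lemma koszul_exact_aux (s : Finset (Fin n)) :
    ∀ a : ExteriorAlgebra (MvPolynomial (Fin n) k) (Fin n → MvPolynomial (Fin n) k),
      (∀ j ∉ s, koszulD (LinearMap.proj j) a = 0) → koszulD (varFun k n) a = 0 →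
      ∃ b c, (∀ j ∉ s, koszulD (LinearMap.proj j) b = 0) ∧
        a = koszulD (varFun k n) b + algebraMap (MvPolynomial (Fin n) k) _ c := by
  induction s using Finset.induction_on with
  | empty =>
    intro a ha _
    obtain ⟨c, hc⟩ := exists_algebraMap_of_proj_eq_zero a fun j => ha j (by simp)
    exact ⟨0, c, by simp, by simp [hc]⟩
  | insert j s hj ih =>
    intro a ha hda
    set A := MvPolynomial (Fin n) k
    set η : Fin n → Module.Dual A (Fin n → A) := fun i => LinearMap.proj i with hη
    set d := koszulD (varFun k n)
    have hηe : ∀ i b, koszulD (η i) (extGen A j * b) =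
        (if i = j then b else 0) - extGen A j * koszulD (η i) b := by
      intro i b
      rw [koszulD_extGen_mul]
      by_cases h : i = j <;> simp [hη, h]
    have hde : ∀ b, d (extGen A j * b) = (X j : A) • b - extGen A j * d b := by
      intro b
      rw [koszulD_extGen_mul, varFun_single, mul_one]
    set c' := koszulD (η j) a with hc'
    have hc's : ∀ i ∉ s, koszulD (η i) c' = 0 := by
      intro i hi
      by_cases h : i = j
      · subst h
        exact koszulD_koszulD _ _
      · rw [hc', koszulD_comm, ha i (by simp [h, hi]), map_zero, neg_zero]
    have hdc' : d c' = 0 := by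
      rw [hc', koszulD_comm, hda, map_zero, neg_zero]
    have hb0s : ∀ i ∉ s, koszulD (η i) (a - extGen A j * c') = 0 := by
      intro i hi
      rw [map_sub, hηe, hc's i hi, mul_zero, sub_zero]
      by_cases h : i = j
      · subst h
        simp [hc']
      · simp [h, hη, ha i (by simp [h, hi])]
    obtain ⟨γ, c0, hγ, hγc⟩ := ih c' hc's hdc'
    have hc0 : c0 ∈ Ideal.span (X '' (s : Set (Fin n)) : Set A) := by
      apply mem_span_X_of_X_mul_mem _ (j := j) (by simpa using hj)
      have h1 := algebraMapInv_koszulD_mem (k := k) (s : Set (Fin n))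
        (a - extGen A j * c' + (X j : A) • γ) (by
          intro i hi
          rw [map_add, hb0s i (by simpa using hi), map_smul, hγ i (by simpa using hi)]
          simp)
      have h2 : d (a - extGen A j * c' + (X j : A) • γ) = - algebraMap _ _ (X j * c0) := by
        rw [map_add, map_sub, hda, hde, hdc', map_smul, map_mul, ← Algebra.smul_def,
          eq_sub_of_add_eq' hγc.symm]
        simp only [smul_sub, mul_zero]
        abel
      rw [h2, map_neg, ExteriorAlgebra.algebraMap_leftInverse, neg_mem_iff] at h1
      exact h1
    obtain ⟨v, hv, hvc⟩ := exists_varFun_eq _ hc0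
    set γ' := γ + ExteriorAlgebra.ι A v with hγ'
    have hιv : ∀ ψ : Module.Dual A (Fin n → A), koszulD ψ (ExteriorAlgebra.ι A v) =
        algebraMap _ _ (ψ v) := by
      intro ψ
      have := koszulD_ι_mul ψ v 1
      rwa [mul_one, koszulD_one, mul_zero, sub_zero, ← Algebra.algebraMap_eq_smul_one] at this
    have hγ's : ∀ i ∉ s, koszulD (η i) γ' = 0 := by
      intro i hi
      rw [hγ', map_add, hγ i hi, hιv]
      simp [hη, hv i (by simpa using hi)]
    have hdγ' : d γ' = c' := by rw [hγ', map_add, hιv, hvc, hγc]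
    obtain ⟨b, c, hb, hbc⟩ := ih (a - extGen A j * c' + (X j : A) • γ') (by
        intro i hi
        rw [map_add, hb0s i hi, map_smul, hγ's i hi]
        simp) (by
        rw [map_add, map_sub, hda, map_smul, hdγ', hde, hdc']
        simp)
    refine ⟨b - extGen A j * γ', c, ?_, ?_⟩
    · intro i hi
      rw [Finset.mem_insert, not_or] at hi
      rw [map_sub, hb i hi.2, hηe, hγ's i hi.2]
      simp [hi.1]
    · rw [map_sub, hde, hdγ', sub_add_eq_add_sub, ← hbc]
      abel

/-- The Koszul complex on the variables of a polynomial ring is a resolution of the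
residue field. -/
lemma koszul_isHomologyBasis {σ : Type} (z : Finset σ →
    ExteriorAlgebra (MvPolynomial (Fin n) k) (Fin n → MvPolynomial (Fin n) k)) (hz : z ∅ = 1) :
    IsHomologyBasis (koszulD (varFun k n)) ⊥ (LinearMap.range (varFun k n))
      (∅ : Finset σ).powerset z := by
  refine ⟨?_, ?_, ?_⟩
  · simp [hz, koszulD_one]
  · intro a ha
    obtain ⟨b, c, -, hbc⟩ := koszul_exact_aux Finset.univ a (by simp) (by simpa using ha)
    refine ⟨b, fun _ => c, ?_⟩
    simp [hz, hbc, Algebra.algebraMap_eq_smul_one]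
  · intro b c hbc
    have h1 := algebraMapInv_koszulD_mem (k := k) Set.univ b (by simp)
    simp only [Finset.powerset_empty, Finset.sum_singleton, hz, Submodule.mem_bot, sub_eq_zero,
      ← Algebra.algebraMap_eq_smul_one] at hbc
    rw [← hbc, ExteriorAlgebra.algebraMap_leftInverse, Set.image_univ] at h1
    simpa [range_varFun] using h1

end KoszulExact

section MonomialIdeal

variable {k : Type} [Field k] {n t : ℕ}

/-- The ideal generated by the monomials indexed by `T`. -/
noncomputable def monIdeal (k : Type) [Field k] (m : Fin t → (Fin n →₀ ℕ)) (T : Finset (Fin t)) :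
    Ideal (MvPolynomial (Fin n) k) :=
  Ideal.span ((fun s => monomial s (1 : k)) '' (m '' T))

lemma mem_monIdeal {m : Fin t → (Fin n →₀ ℕ)} {T : Finset (Fin t)} {x : MvPolynomial (Fin n) k} :
    x ∈ monIdeal k m T ↔ ∀ ξ ∈ x.support, ∃ j ∈ T, m j ≤ ξ := by
  rw [monIdeal, mem_ideal_span_monomial_image]
  simp

lemma monomial_mem_monIdeal {m : Fin t → (Fin n →₀ ℕ)} {T : Finset (Fin t)} {ξ : Fin n →₀ ℕ}
    {j : Fin t} (hj : j ∈ T) (h : m j ≤ ξ) : monomial ξ (1 : k) ∈ monIdeal k m T := by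
  rw [mem_monIdeal]
  intro η hη
  rw [mem_support_iff, coeff_monomial] at hη
  rw [← (ite_ne_right_iff.1 hη).1]
  exact ⟨j, hj, h⟩

lemma monIdeal_insert [DecidableEq (Fin t)] (m : Fin t → (Fin n →₀ ℕ)) (a : Fin t)
    (T : Finset (Fin t)) :
    monIdeal k m (insert a T) = Ideal.span {monomial (m a) (1 : k)} ⊔ monIdeal k m T := by
  rw [monIdeal, monIdeal, Finset.coe_insert, Set.image_insert_eq, Set.image_insert_eq,
    Ideal.span_insert]

lemma monomial_mul_mem_monIdeal {m : Fin t → (Fin n →₀ ℕ)} {T : Finset (Fin t)} (a : Fin t)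
    (y : MvPolynomial (Fin n) k) :
    monomial (m a) (1 : k) * y ∈ monIdeal k m T ↔ y ∈ monIdeal k (fun j => m j - m a) T := by
  simp only [mem_monIdeal]
  constructor
  · intro h ξ hξ
    obtain ⟨j, hj, hle⟩ := h (m a + ξ) (by
      rw [mem_support_iff] at hξ ⊢
      rwa [coeff_monomial_mul, one_mul])
    exact ⟨j, hj, tsub_le_iff_left.2 hle⟩
  · intro h ξ hξ
    rw [mem_support_iff, coeff_monomial_mul'] at hξ
    obtain ⟨hle, hne⟩ := ite_ne_right_iff.1 hξ
    rw [one_mul] at hne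
    obtain ⟨j, hj, hj'⟩ := h (ξ - m a) (mem_support_iff.2 hne)
    refine ⟨j, hj, ?_⟩
    rwa [tsub_le_tsub_iff_right hle] at hj'

/-- Every `m j`, `j ∈ T`, has strictly larger exponent at the variable `p j` than all the other
monomials indexed by `T`. -/
def IsPrivate (m : Fin t → (Fin n →₀ ℕ)) (p : Fin t → Fin n) (T : Finset (Fin t)) : Prop :=
  ∀ j ∈ T, 0 < m j (p j) ∧ ∀ i ∈ T, i ≠ j → m i (p j) < m j (p j)

lemma IsPrivate.mono {m : Fin t → (Fin n →₀ ℕ)} {p : Fin t → Fin n} {S T : Finset (Fin t)}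
    (h : IsPrivate m p T) (hST : S ⊆ T) : IsPrivate m p S :=
  fun j hj => ⟨(h j (hST hj)).1, fun i hi => (h j (hST hj)).2 i (hST hi)⟩

lemma IsPrivate.injOn {m : Fin t → (Fin n →₀ ℕ)} {p : Fin t → Fin n} {T : Finset (Fin t)}
    (h : IsPrivate m p T) {i j : Fin t} (hi : i ∈ T) (hj : j ∈ T) (hij : p i = p j) : i = j := by
  by_contra hne
  have h1 := (h j hj).2 i hi hne
  have h2 := (h i hi).2 j hj (Ne.symm hne)
  rw [hij] at h2
  omega

lemma IsPrivate.sub {m : Fin t → (Fin n →₀ ℕ)} {p : Fin t → Fin n} {T : Finset (Fin t)} {a : Fin t}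
    (ha : a ∉ T) (h : IsPrivate m p (insert a T)) : IsPrivate (fun j => m j - m a) p T := by
  intro j hj
  have hj' := h j (Finset.mem_insert_of_mem hj)
  have h1 := hj'.2 a (Finset.mem_insert_self _ _) (fun e => ha (e ▸ hj))
  refine ⟨by simpa using h1, fun i hi hij => ?_⟩
  have h2 := hj'.2 i (Finset.mem_insert_of_mem hi) hij
  simp only [Finsupp.coe_tsub, Pi.sub_apply]
  omega

/-- The exponent of the coefficient of the cycle attached to `S`. -/
noncomputable def cycExp (m : Fin t → (Fin n →₀ ℕ)) (p : Fin t → Fin n) (S : Finset (Fin t)) :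
    Fin n →₀ ℕ :=
  S.sup m - ∑ j ∈ S, Finsupp.single (p j) 1

lemma finsupp_sup_apply (m : Fin t → (Fin n →₀ ℕ)) (S : Finset (Fin t)) (q : Fin n) :
    S.sup m q = S.sup fun j => m j q := by
  induction S using Finset.induction_on with
  | empty => rfl
  | insert a S _ ih => rw [Finset.sup_insert, Finset.sup_insert, Finsupp.sup_apply, ih]

lemma le_finsupp_sup (m : Fin t → (Fin n →₀ ℕ)) {S : Finset (Fin t)} {j : Fin t} (hj : j ∈ S)
    (q : Fin n) : m j q ≤ S.sup m q :=
  Finset.le_sup (f := m) hj q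

lemma sum_single_apply_of_notMem {p : Fin t → Fin n} {S : Finset (Fin t)} {q : Fin n}
    (hq : ∀ j ∈ S, p j ≠ q) : (∑ j ∈ S, Finsupp.single (p j) 1 : Fin n →₀ ℕ) q = 0 := by
  rw [Finsupp.finsetSum_apply]
  exact Finset.sum_eq_zero fun j hj => Finsupp.single_eq_of_ne (hq j hj).symm

lemma IsPrivate.sum_single_apply {m : Fin t → (Fin n →₀ ℕ)} {p : Fin t → Fin n}
    {S : Finset (Fin t)} (h : IsPrivate m p S) {j : Fin t} (hj : j ∈ S) :
    (∑ j ∈ S, Finsupp.single (p j) 1 : Fin n →₀ ℕ) (p j) = 1 := by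
  rw [Finsupp.finsetSum_apply, Finset.sum_eq_single j]
  · simp
  · intro i hi hij
    exact Finsupp.single_eq_of_ne fun e => hij (h.injOn hi hj e.symm)
  · exact fun hj' => absurd hj hj'

lemma IsPrivate.le_cycExp_add {m : Fin t → (Fin n →₀ ℕ)} {p : Fin t → Fin n}
    {S : Finset (Fin t)} (h : IsPrivate m p S) {j : Fin t} (hj : j ∈ S) :
    m j ≤ cycExp m p S + Finsupp.single (p j) 1 := by
  intro q
  simp only [cycExp, Finsupp.coe_add, Finsupp.coe_tsub, Pi.add_apply, Pi.sub_apply]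
  have h1 := le_finsupp_sup m hj q
  by_cases hq : ∃ i ∈ S, p i = q
  · obtain ⟨i, hi, rfl⟩ := hq
    rw [h.sum_single_apply hi]
    by_cases hij : i = j
    · subst hij
      rw [Finsupp.single_eq_same]
      omega
    · have h2 := (h i hi).2 j hj (Ne.symm hij)
      have h3 := le_finsupp_sup m hi (p i)
      omega
  · push Not at hq
    rw [sum_single_apply_of_notMem hq]
    omega

lemma IsPrivate.cycExp_insert_add {m : Fin t → (Fin n →₀ ℕ)} {p : Fin t → Fin n}
    {S : Finset (Fin t)} {a : Fin t} (ha : a ∉ S) (h : IsPrivate m p (insert a S)) :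
    cycExp m p (insert a S) + Finsupp.single (p a) 1 =
      m a + cycExp (fun j => m j - m a) p S := by
  have hsup : ∀ q, S.sup (fun j => m j - m a) q = S.sup m q - m a q := by
    intro q
    rw [finsupp_sup_apply, finsupp_sup_apply]
    simp only [Finsupp.coe_tsub, Pi.sub_apply]
    exact (Finset.apply_sup_eq_sup_comp (fun x : ℕ => x - m a q)
      (fun x y => by simp only [max_def]; split_ifs <;> omega) (by simp)).symm
  ext q
  simp only [cycExp, Finsupp.coe_add, Finsupp.coe_tsub, Pi.add_apply, Pi.sub_apply,
    Finset.sup_insert, Finset.sum_insert ha, Finsupp.sup_apply, hsup]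
  by_cases hqa : q = p a
  · subst hqa
    rw [sum_single_apply_of_notMem fun j hj e => ha
      (h.injOn (Finset.mem_insert_of_mem hj) (Finset.mem_insert_self _ _) e ▸ hj),
      Finsupp.single_eq_same]
    have := (h a (Finset.mem_insert_self _ _)).1
    simp only [max_def]
    split_ifs <;> omega
  · rw [Finsupp.single_eq_of_ne hqa]
    by_cases hq : ∃ i ∈ S, p i = q
    · obtain ⟨i, hi, rfl⟩ := hq
      rw [(h.mono (Finset.subset_insert _ _)).sum_single_apply hi]
      have h1 := (h i (Finset.mem_insert_of_mem hi)).2 a (Finset.mem_insert_self _ _)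
        (fun e => ha (e ▸ hi))
      have h2 := le_finsupp_sup m hi (p i)
      simp only [max_def]
      split_ifs <;> omega
    · push Not at hq
      rw [sum_single_apply_of_notMem hq]
      simp only [max_def]
      split_ifs <;> omega

/-- The product of the generators at the positions `p j`, `j ∈ l`. -/
noncomputable def extProd (k : Type) [Field k] (p : Fin t → Fin n) (l : List (Fin t)) :
    ExteriorAlgebra (MvPolynomial (Fin n) k) (Fin n → MvPolynomial (Fin n) k) :=
  (l.map fun j => extGen (MvPolynomial (Fin n) k) (p j)).prod

/-- The Koszul cycle attached to a set of monomials. -/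
noncomputable def koszulCycle (k : Type) [Field k] (m : Fin t → (Fin n →₀ ℕ)) (p : Fin t → Fin n)
    (S : Finset (Fin t)) :
    ExteriorAlgebra (MvPolynomial (Fin n) k) (Fin n → MvPolynomial (Fin n) k) :=
  monomial (cycExp m p S) (1 : k) • extProd k p (S.sort (· ≤ ·))

lemma smul_koszulD_extProd_mem {p : Fin t → Fin n} {l : List (Fin t)}
    {I : Ideal (MvPolynomial (Fin n) k)} {r : MvPolynomial (Fin n) k}
    (h : ∀ j ∈ l, r * X (p j) ∈ I) :
    r • koszulD (varFun k n) (extProd k p l) ∈ I • (⊤ : Submodule (MvPolynomial (Fin n) k)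
      (ExteriorAlgebra (MvPolynomial (Fin n) k) (Fin n → MvPolynomial (Fin n) k))) := by
  induction l with
  | nil => simp [extProd, koszulD_one]
  | cons j l ih =>
    have : extProd k p (j :: l) = extGen _ (p j) * extProd k p l := by simp [extProd]
    rw [this, koszulD_extGen_mul, smul_sub, varFun_single, mul_one, smul_smul, ← mul_smul_comm]
    refine Submodule.sub_mem _ (Submodule.smul_mem_smul (h j (by simp)) trivial) ?_
    exact mul_mem_smul_top _ (ih fun i hi => h i (by simp [hi]))

lemma mem_monIdeal_insert_smul_top {B : Type} [AddCommGroup B] [Module (MvPolynomial (Fin n) k) B]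
    (m : Fin t → (Fin n →₀ ℕ)) (a : Fin t) (T : Finset (Fin t)) (x : B) :
    x ∈ monIdeal k m (insert a T) • (⊤ : Submodule (MvPolynomial (Fin n) k) B) ↔
      ∃ y, x - monomial (m a) (1 : k) • y ∈
        monIdeal k m T • (⊤ : Submodule (MvPolynomial (Fin n) k) B) := by
  rw [monIdeal_insert, Submodule.sup_smul, Submodule.mem_sup]
  constructor
  · rintro ⟨y, hy, z, hz, rfl⟩
    rw [Submodule.ideal_span_singleton_smul, Submodule.mem_smul_pointwise_iff_exists] at hy
    obtain ⟨w, -, rfl⟩ := hy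
    exact ⟨w, by simpa using hz⟩
  · rintro ⟨y, hy⟩
    exact ⟨_, Submodule.smul_mem_smul (Ideal.mem_span_singleton_self _) trivial, _, hy, by abel⟩

/-- The Koszul homology of a monomial ring with minimal Taylor resolution. -/
lemma koszulCycle_isHomologyBasis (p : Fin t → Fin n) (T : Finset (Fin t)) :
    ∀ m : Fin t → (Fin n →₀ ℕ), IsPrivate m p T →
    IsHomologyBasis (koszulD (varFun k n)) (monIdeal k m T • ⊤) (LinearMap.range (varFun k n))
      T.powerset (koszulCycle k m p) := by
  induction T using Finset.induction_on_min with
  | empty =>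
    intro m _
    have : monIdeal k m ∅ = ⊥ := by simp [monIdeal]
    rw [this, Submodule.bot_smul]
    apply koszul_isHomologyBasis
    simp only [koszulCycle, extProd, cycExp, Finset.sort_empty, List.map_nil, List.prod_nil,
      Finset.sup_empty, Finset.sum_empty, tsub_zero]
    exact one_smul _ _
  | insert a T hlt ih =>
    intro m hm
    have ha : a ∉ T := fun h => lt_irrefl _ (hlt a h)
    refine IsHomologyBasis.powerset_insert (koszulD_koszulD (varFun k n))
      (μ := monomial (m a) (1 : k))
      (fun x hx => map_mem_smul_top _ hx) (mem_monIdeal_insert_smul_top m a T) ?_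
      (fun c hc z hz => smul_cycle_boundary (varFun k n) hc hz) ha
      (ih m (hm.mono (Finset.subset_insert _ _))) (ih _ (hm.sub ha)) ?_
    · intro y
      have b := (Pi.basisFun (MvPolynomial (Fin n) k) (Fin n)).ExteriorAlgebra
      rw [mem_smul_top_iff_repr b, mem_smul_top_iff_repr b]
      refine forall_congr' fun i => ?_
      rw [map_smul, Finsupp.smul_apply, smul_eq_mul, monomial_mul_mem_monIdeal]
    · intro S hS
      rw [Finset.mem_powerset] at hS
      have haS : a ∉ S := fun h => ha (hS h)
      have hmS := hm.mono (Finset.insert_subset_insert a hS)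
      have hsort : (insert a S).sort (· ≤ ·) = a :: S.sort (· ≤ ·) :=
        Finset.sort_insert (· ≤ ·) (fun b hb => (hlt b (hS hb)).le) haS
      have hprod : extProd k p (a :: S.sort (· ≤ ·)) =
        extGen _ (p a) * extProd k p (S.sort (· ≤ ·)) := by simp [extProd]
      rw [koszulCycle, koszulCycle, hsort, hprod, map_smul, koszulD_extGen_mul, smul_sub,
        varFun_single, mul_one, smul_smul, smul_smul, X, monomial_mul, monomial_mul,
        hmS.cycExp_insert_add haS, sub_sub_cancel_left, neg_mem_iff, ← mul_smul_comm]
      refine mul_mem_smul_top _ (smul_koszulD_extProd_mem fun j hj => ?_)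
      rw [Finset.mem_sort] at hj
      rw [X, monomial_mul, one_mul]
      exact monomial_mem_monIdeal (hS hj) (hmS.le_cycExp_add (Finset.mem_insert_of_mem hj))

end MonomialIdeal

section GolodResolution

variable {A K σ : Type} [CommRing A] [AddCommGroup K] [Module A K] [Fintype σ]

/-- The differential of the iterated mapping cone with components indexed by words. -/
def golodD (d : K →ₗ[A] K) (ψ : σ → K →ₗ[A] K) : (List σ → K) →ₗ[A] (List σ → K) :=
  LinearMap.pi fun l => d ∘ₗ LinearMap.proj l + ∑ v, ψ v ∘ₗ LinearMap.proj (v :: l)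

lemma golodD_apply (d : K →ₗ[A] K) (ψ : σ → K →ₗ[A] K) (f : List σ → K) (l : List σ) :
    golodD d ψ f l = d (f l) + ∑ v, ψ v (f (v :: l)) := by
  simp [golodD]

/-- The data making `golodD d ψ` an acyclic differential modulo `N`. -/
structure IsGolodDatum (d : K →ₗ[A] K) (N : Submodule A K) (𝔪 : Ideal A) (e : K)
    (ψ : σ → K →ₗ[A] K) : Prop where
  d_mem : ∀ x ∈ N, d x ∈ N
  ψ_mem : ∀ v, ∀ x ∈ N, ψ v x ∈ N
  d_d : ∀ x, d (d x) = 0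
  d_ψ : ∀ v x, d (ψ v x) + ψ v (d x) ∈ N
  ψ_ψ : ∀ v w x, ψ v (ψ w x) = 0
  d_one : d e = 0
  span : ∀ a, d a ∈ N → ∃ (b : K) (c₀ : A) (c : σ → A),
    a - d b - c₀ • e - ∑ v, c v • ψ v e ∈ N
  indep : ∀ (b : K) (c : σ → A), d b + ∑ v, c v • ψ v e ∈ N → ∀ v, c v ∈ 𝔪
  lift : ∀ c ∈ 𝔪, ∃ y, d y = c • e

namespace IsGolodDatum

variable {d : K →ₗ[A] K} {N : Submodule A K} {𝔪 : Ideal A} {e : K} {ψ : σ → K →ₗ[A] K}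

lemma golodD_mem (h : IsGolodDatum d N 𝔪 e ψ) {f : List σ → K} (hf : ∀ l, f l ∈ N)
    (l : List σ) : golodD d ψ f l ∈ N := by
  rw [golodD_apply]
  exact add_mem (h.d_mem _ (hf _)) (Submodule.sum_mem _ fun v _ => h.ψ_mem v _ (hf _))

lemma golodD_golodD_mem (h : IsGolodDatum d N 𝔪 e ψ) (f : List σ → K) (l : List σ) :
    golodD d ψ (golodD d ψ f) l ∈ N := by
  have : golodD d ψ (golodD d ψ f) l =
      ∑ v, (d (ψ v (f (v :: l))) + ψ v (d (f (v :: l)))) := by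
    rw [golodD_apply]
    simp only [golodD_apply, map_add, map_sum, h.d_d, h.ψ_ψ, Finset.sum_const_zero, add_zero,
      zero_add, Finset.sum_add_distrib]
  rw [this]
  exact Submodule.sum_mem _ fun v _ => h.d_ψ v _

/-- Changing a cycle by a boundary so that its components of maximal length become scalars. -/
lemma exists_scalar_top (h : IsGolodDatum d N 𝔪 e ψ) (M : ℕ) (f : List σ → K)
    (hf : ∀ l, M < l.length → f l ∈ N) (hD : ∀ l, golodD d ψ f l ∈ N) :
    ∃ (g : List σ → K) (c₀ : List σ → A), (∀ l, M < l.length → f l - golodD d ψ g l ∈ N) ∧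
      ∀ l, l.length = M → f l - golodD d ψ g l - c₀ l • e ∈ N := by
  have key : ∀ l : List σ, ∃ (b : K) (c₀ : A) (c : σ → A), l.length = M →
      f l - d b - c₀ • e - ∑ v, c v • ψ v e ∈ N := by
    intro l
    by_cases hl : l.length = M
    · have hd : d (f l) ∈ N := by
        have := hD l
        rw [golodD_apply] at this
        refine (Submodule.add_mem_iff_left N (Submodule.sum_mem _ fun v _ =>
          h.ψ_mem v _ (hf _ ?_))).1 this
        simp [hl]
      obtain ⟨b, c₀, c, hb⟩ := h.span _ hd
      exact ⟨b, c₀, c, fun _ => hb⟩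
    · exact ⟨0, 0, 0, fun h' => absurd h' hl⟩
  choose b c₀ c hbc using key
  let g : List σ → K := fun l => if l.length = M then b l else
    match l with
    | [] => 0
    | v :: l => if l.length = M then c l v • e else 0
  have g1 : ∀ l, l.length = M → g l = b l := fun l hl => if_pos hl
  have g2 : ∀ v l, l.length = M → g (v :: l) = c l v • e := by
    intro v l hl
    have : ¬ (v :: l).length = M := by simp [hl]
    simp only [g, if_neg this, if_pos hl]
  have g3 : ∀ v l, M < l.length → g (v :: l) = 0 := by
    intro v l hl
    have h1 : ¬ (v :: l).length = M := by rw [List.length_cons]; omega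
    simp only [g, if_neg h1, if_neg hl.ne']
  refine ⟨g, c₀, fun l hl => ?_, fun l hl => ?_⟩
  · refine Submodule.sub_mem _ (hf l hl) ?_
    rw [golodD_apply]
    simp only [g3 _ l hl, map_zero, Finset.sum_const_zero, add_zero]
    cases l with
    | nil => simp at hl
    | cons v l =>
      rcases (Nat.lt_succ_iff.1 hl).eq_or_lt with h1 | h1
      · rw [g2 v l h1.symm, map_smul, h.d_one, smul_zero]
        exact N.zero_mem
      · rw [g3 v l h1, map_zero]
        exact N.zero_mem
  · rw [golodD_apply, g1 l hl]
    simp only [g2 _ l hl, map_smul]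
    convert hbc l hl using 1
    abel

/-- Acyclicity of the iterated mapping cone modulo `N`. -/
lemma exists_boundary (h : IsGolodDatum d N 𝔪 e ψ) (M : ℕ) : ∀ f : List σ → K,
    (∀ l, M < l.length → f l ∈ N) → (∀ l, golodD d ψ f l ∈ N) →
    ∃ (g : List σ → K) (c : A), (∀ l, l ≠ [] → f l - golodD d ψ g l ∈ N) ∧
      f [] - golodD d ψ g [] - c • e ∈ N := by
  induction M with
  | zero =>
    intro f hf hD
    obtain ⟨g, c₀, h1, h2⟩ := h.exists_scalar_top 0 f hf hD
    exact ⟨g, c₀ [], fun l hl => h1 l (List.length_pos_iff.2 hl), h2 [] rfl⟩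
  | succ M ih =>
    intro f hf hD
    obtain ⟨g, c₀, h1, h2⟩ := h.exists_scalar_top (M + 1) f hf hD
    have hc : ∀ l, ∃ y, l.length = M + 1 → d y = c₀ l • e := by
      intro l
      cases l with
      | nil => exact ⟨0, fun h => by simp at h⟩
      | cons v l =>
        by_cases hl : l.length = M
        · have hl' : ∀ w, (w :: l).length = M + 1 := fun w => by simp [hl]
          have h3 := Submodule.sub_mem _ (hD l) (h.golodD_golodD_mem g l)
          rw [← Pi.sub_apply, ← map_sub, golodD_apply] at h3
          have h4 : ∑ w, ψ w ((f - golodD d ψ g) (w :: l) - c₀ (w :: l) • e) ∈ N :=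
            Submodule.sum_mem _ fun w _ => h.ψ_mem w _ (h2 _ (hl' w))
          have h5 := h.indep ((f - golodD d ψ g) l) (fun w => c₀ (w :: l)) (by
            convert Submodule.sub_mem _ h3 h4 using 1
            simp only [map_sub, map_smul, Finset.sum_sub_distrib]
            abel)
          obtain ⟨y, hy⟩ := h.lift _ (h5 v)
          exact ⟨y, fun _ => hy⟩
        · exact ⟨0, fun h => absurd (Nat.succ_injective h) hl⟩
    choose y hy using hc
    let g' : List σ → K := fun l => if l.length = M + 1 then y l else 0
    have g'0 : ∀ l, M + 1 < l.length → g' l = 0 := fun l hl => if_neg hl.ne'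
    have hg' : ∀ l, M < l.length → ∀ v, g' (v :: l) = 0 := fun l hl v => g'0 _ (by simpa using hl)
    obtain ⟨g'', c, h3, h4⟩ := ih (f - golodD d ψ g - golodD d ψ g') (fun l hl => by
        simp only [Pi.sub_apply]
        rw [golodD_apply d ψ g']
        simp only [hg' l hl, map_zero, Finset.sum_const_zero, add_zero]
        rcases (Nat.succ_le_of_lt hl).eq_or_lt with h5 | h5
        · have : g' l = y l := if_pos h5.symm
          rw [this, hy l h5.symm]
          exact h2 l h5.symm
        · rw [g'0 l h5, map_zero, sub_zero]
          exact h1 l h5)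
      (fun l => by
        rw [map_sub, map_sub]
        exact Submodule.sub_mem _ (Submodule.sub_mem _ (hD l) (h.golodD_golodD_mem g l))
          (h.golodD_golodD_mem g' l))
    refine ⟨g + g' + g'', c, fun l hl => ?_, ?_⟩
    · convert h3 l hl using 1
      simp only [map_add, Pi.add_apply, Pi.sub_apply]
      abel
    · convert h4 using 1
      simp only [map_add, Pi.add_apply, Pi.sub_apply]
      abel

end IsGolodDatum

end GolodResolution

section TriviallyGolod

variable {k : Type} [Field k] {n t : ℕ}

/-- The cycle by which the letter `S` multiplies. -/
noncomputable def golodCycle (p : Fin t → Fin n)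
    (c : {S : Finset (Fin t) // S.Nonempty} → MvPolynomial (Fin n) k)
    (S : {S : Finset (Fin t) // S.Nonempty}) :
    ExteriorAlgebra (MvPolynomial (Fin n) k) (Fin n → MvPolynomial (Fin n) k) :=
  c S • koszulD (varFun k n) (extProd k p (S.1.sort (· ≤ ·)))

/-- The connecting operators `a ↦ y a w_S` of the iterated mapping cone. -/
noncomputable def golodψ (p : Fin t → Fin n)
    (c : {S : Finset (Fin t) // S.Nonempty} → MvPolynomial (Fin n) k)
    (y : Fin n → MvPolynomial (Fin n) k) (S : {S : Finset (Fin t) // S.Nonempty}) :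
    ExteriorAlgebra (MvPolynomial (Fin n) k) (Fin n → MvPolynomial (Fin n) k)
      →ₗ[MvPolynomial (Fin n) k]
    ExteriorAlgebra (MvPolynomial (Fin n) k) (Fin n → MvPolynomial (Fin n) k) :=
  LinearMap.mulLeft _ (ExteriorAlgebra.ι _ y) ∘ₗ LinearMap.mulRight _ (golodCycle p c S)

lemma golodψ_apply (p : Fin t → Fin n)
    (c : {S : Finset (Fin t) // S.Nonempty} → MvPolynomial (Fin n) k)
    (y : Fin n → MvPolynomial (Fin n) k) (S : {S : Finset (Fin t) // S.Nonempty})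
    (a : ExteriorAlgebra (MvPolynomial (Fin n) k) (Fin n → MvPolynomial (Fin n) k)) :
    golodψ p c y S a = ExteriorAlgebra.ι _ y * (a * golodCycle p c S) := rfl

lemma koszulD_golodCycle (p : Fin t → Fin n)
    (c : {S : Finset (Fin t) // S.Nonempty} → MvPolynomial (Fin n) k)
    (S : {S : Finset (Fin t) // S.Nonempty}) :
    koszulD (varFun k n) (golodCycle p c S) = 0 := by
  rw [golodCycle, map_smul, koszulD_koszulD, smul_zero]

lemma koszulD_varFun_mem
    (a : ExteriorAlgebra (MvPolynomial (Fin n) k) (Fin n → MvPolynomial (Fin n) k)) :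
    koszulD (varFun k n) a ∈ LinearMap.range (varFun k n) •
      (⊤ : Submodule (MvPolynomial (Fin n) k) (ExteriorAlgebra (MvPolynomial (Fin n) k)
        (Fin n → MvPolynomial (Fin n) k))) := by
  rw [koszulD_varFun]
  refine Submodule.sum_mem _ fun j _ => Submodule.smul_mem_smul ?_ trivial
  rw [range_varFun]
  exact Ideal.subset_span ⟨j, rfl⟩

lemma golodψ_mem (p : Fin t → Fin n)
    (c : {S : Finset (Fin t) // S.Nonempty} → MvPolynomial (Fin n) k)
    (y : Fin n → MvPolynomial (Fin n) k) (S : {S : Finset (Fin t) // S.Nonempty})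
    (a : ExteriorAlgebra (MvPolynomial (Fin n) k) (Fin n → MvPolynomial (Fin n) k)) :
    golodψ p c y S a ∈ LinearMap.range (varFun k n) •
      (⊤ : Submodule (MvPolynomial (Fin n) k) (ExteriorAlgebra (MvPolynomial (Fin n) k)
        (Fin n → MvPolynomial (Fin n) k))) := by
  rw [golodψ_apply]
  exact mul_mem_smul_top _ (mul_mem_smul_top _
    (Submodule.smul_mem _ _ (koszulD_varFun_mem _)))

lemma sum_powerset_univ_eq {B : Type} [AddCommMonoid B] (f : Finset (Fin t) → B) :
    ∑ S ∈ (Finset.univ : Finset (Fin t)).powerset, f S =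
      f ∅ + ∑ S : {S : Finset (Fin t) // S.Nonempty}, f S := by
  classical
  rw [Finset.powerset_univ, ← Finset.sum_erase_add _ _ (Finset.mem_univ ∅), add_comm]
  congr 1
  refine Finset.sum_subtype _ (fun S => ?_) f
  simp [Finset.nonempty_iff_ne_empty]

/-- The iterated mapping cone of a trivially Golod monomial ring is acyclic. -/
lemma isGolodDatum {m : Fin t → (Fin n →₀ ℕ)} {p : Fin t → Fin n}
    (hp : IsPrivate m p Finset.univ)
    {c : {S : Finset (Fin t) // S.Nonempty} → MvPolynomial (Fin n) k}
    {y : Fin n → MvPolynomial (Fin n) k}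
    (hc : ∀ S, varFun k n y * c S = monomial (cycExp m p S) (1 : k)) :
    IsGolodDatum (koszulD (varFun k n)) (monIdeal k m Finset.univ • ⊤)
      (LinearMap.range (varFun k n)) 1 (golodψ p c y) := by
  have hx : ∀ S : {S : Finset (Fin t) // S.Nonempty}, varFun k n y • golodCycle p c S ∈
      monIdeal k m Finset.univ • (⊤ : Submodule (MvPolynomial (Fin n) k)
        (ExteriorAlgebra (MvPolynomial (Fin n) k) (Fin n → MvPolynomial (Fin n) k))) := by
    intro S
    rw [golodCycle, smul_smul, hc]
    refine smul_koszulD_extProd_mem fun j hj => ?_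
    rw [Finset.mem_sort] at hj
    rw [X, monomial_mul, one_mul]
    exact monomial_mem_monIdeal (Finset.mem_univ j)
      ((hp.mono (Finset.subset_univ S.1)).le_cycExp_add hj)
  have hz : koszulCycle k m p ∅ = 1 := by
    simp only [koszulCycle, extProd, cycExp, Finset.sort_empty, List.map_nil, List.prod_nil,
      Finset.sup_empty, Finset.sum_empty, tsub_zero]
    exact one_smul _ _
  have hψ : ∀ S : {S : Finset (Fin t) // S.Nonempty}, koszulCycle k m p S = golodψ p c y S 1 +
      koszulD (varFun k n) (c S • (ExteriorAlgebra.ι _ y * extProd k p (S.1.sort (· ≤ ·)))) := by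
    intro S
    rw [golodψ_apply, one_mul, golodCycle, map_smul, koszulD_ι_mul, smul_sub, smul_smul,
      mul_comm (c S), hc, mul_smul_comm, koszulCycle]
    abel
  have H := koszulCycle_isHomologyBasis (k := k) p Finset.univ m hp
  constructor
  · exact fun x hx => map_mem_smul_top _ hx
  · exact fun v x hx => map_mem_smul_top _ hx
  · exact koszulD_koszulD _
  · intro S a
    rw [golodψ_apply, golodψ_apply, koszulD_ι_mul,
      koszulD_mul_cycle _ (koszulD_golodCycle p c S), sub_add_cancel, ← mul_smul_comm]
    exact mul_mem_smul_top _ (hx S)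
  · intro S T a
    rw [golodψ_apply, golodψ_apply, mul_assoc, ← mul_assoc, ExteriorAlgebra.ι_sq_zero, zero_mul]
  · exact koszulD_one _
  · intro a ha
    obtain ⟨b, e, h⟩ := H.span a ha
    refine ⟨b + ∑ S : {S : Finset (Fin t) // S.Nonempty}, e S • (c S • (ExteriorAlgebra.ι _ y *
      extProd k p (S.1.sort (· ≤ ·)))), e ∅, fun S => e S, ?_⟩
    rw [sum_powerset_univ_eq, hz] at h
    convert h using 1
    simp only [hψ, smul_add, Finset.sum_add_distrib, map_add, map_sum, map_smul]
    abel
  · intro b e h S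
    have := H.indep (-b + ∑ S : {S : Finset (Fin t) // S.Nonempty}, e S • (c S •
      (ExteriorAlgebra.ι _ y * extProd k p (S.1.sort (· ≤ ·)))))
      (fun S => if hS : S.Nonempty then e ⟨S, hS⟩ else 0) (by
        rw [sum_powerset_univ_eq]
        convert h using 1
        have he : ∀ S : {S : Finset (Fin t) // S.Nonempty},
          (if hS : S.1.Nonempty then e ⟨S, hS⟩ else 0) = e S := fun S => dif_pos S.2
        simp only [he, Finset.not_nonempty_empty, dif_neg, not_false_eq_true, zero_smul, zero_add,
          hψ, smul_add, Finset.sum_add_distrib,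
          map_add, map_sum, map_smul, map_neg]
        abel) S.1 (Finset.mem_powerset.2 (Finset.subset_univ _))
    simpa [S.2] using this
  · rintro _ ⟨v, rfl⟩
    refine ⟨ExteriorAlgebra.ι _ v, ?_⟩
    rw [← mul_one (ExteriorAlgebra.ι _ v), koszulD_ι_mul, koszulD_one, mul_zero, sub_zero]

end TriviallyGolod

section Resolution

variable {R : Type} [CommRing R] {X : ℕ → Type} [∀ j, AddCommGroup (X j)] [∀ j, Module R (X j)]

/-- The chain complex of modules with the given differentials. -/
noncomputable def moduleComplex (d : ∀ j, X (j + 1) →ₗ[R] X j)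
    (hdd : ∀ j x, d j (d (j + 1) x) = 0) : ChainComplex (ModuleCat.{0} R) ℕ :=
  ChainComplex.of (fun j => ModuleCat.of R (X j)) (fun j => ModuleCat.ofHom (d j))
    (fun j => by ext x; exact hdd j x)

lemma moduleComplex_d (d : ∀ j, X (j + 1) →ₗ[R] X j) (hdd : ∀ j x, d j (d (j + 1) x) = 0)
    (j : ℕ) : (moduleComplex d hdd).d (j + 1) j = ModuleCat.ofHom (d j) :=
  ChainComplex.of_d (fun j => ModuleCat.of R (X j)) (fun j => ModuleCat.ofHom (d j)) j

lemma moduleComplex_exactAt_succ (d : ∀ j, X (j + 1) →ₗ[R] X j)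
    (hdd : ∀ j x, d j (d (j + 1) x) = 0) (hex : ∀ j x, d j x = 0 → ∃ y, d (j + 1) y = x) (j : ℕ) :
    (moduleComplex d hdd).ExactAt (j + 1) := by
  rw [HomologicalComplex.exactAt_iff' _ (j + 2) (j + 1) j (by simp) (by simp),
    ShortComplex.moduleCat_exact_iff]
  intro x hx
  change (moduleComplex d hdd).d (j + 1) j x = 0 at hx
  rw [moduleComplex_d] at hx
  obtain ⟨y, hy⟩ := hex j x hx
  refine ⟨y, ?_⟩
  change (moduleComplex d hdd).d (j + 1 + 1) (j + 1) y = x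
  rw [moduleComplex_d]
  exact hy

/-- An exact sequence of projective modules gives a projective resolution. -/
noncomputable def moduleResolution [∀ j, Module.Projective R (X j)] {Z : Type} [AddCommGroup Z]
    [Module R Z] (d : ∀ j, X (j + 1) →ₗ[R] X j)
    (hdd : ∀ j x, d j (d (j + 1) x) = 0) (hex : ∀ j x, d j x = 0 → ∃ y, d (j + 1) y = x)
    (ε : X 0 →ₗ[R] Z) (hε : Function.Surjective ε) (hεd : ∀ x, ε (d 0 x) = 0)
    (hεex : ∀ x, ε x = 0 → ∃ y, d 0 y = x) : ProjectiveResolution (ModuleCat.of R Z) where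
  complex := moduleComplex d hdd
  projective j := (IsProjective.iff_projective (R := R) (X j)).1 inferInstance
  π := (ChainComplex.toSingle₀Equiv _ _).symm ⟨ModuleCat.ofHom ε, by
    rw [moduleComplex_d]
    ext x
    exact hεd x⟩
  quasiIso := ⟨fun j => by
    cases j with
    | zero =>
      rw [ChainComplex.quasiIsoAt₀_iff, ShortComplex.quasiIso_iff_of_zeros' _ rfl rfl rfl]
      constructor
      · rw [ShortComplex.moduleCat_exact_iff]
        intro x hx
        obtain ⟨y, hy⟩ := hεex x (by simpa using! hx)
        refine ⟨y, ?_⟩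
        change (moduleComplex d hdd).d (0 + 1) 0 y = x
        rw [moduleComplex_d]
        exact hy
      · rw [ModuleCat.epi_iff_surjective]
        intro z
        obtain ⟨x, hx⟩ := hε z
        exact ⟨x, by simpa using! hx⟩
    | succ j =>
      rw [quasiIsoAt_iff_exactAt' (hL := ChainComplex.exactAt_succ_single_obj ..)]
      exact moduleComplex_exactAt_succ d hdd hex j⟩

end Resolution

section TorComputation

variable {R : Type} [CommRing R]

/-- Tensoring with `R ⧸ J` kills maps with entries in `J`. -/
lemma lTensor_eq_zero_of_mem {J : Ideal R} {X : Type} [AddCommGroup X] [Module R X]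
    {Γ : Type} [Fintype Γ] (f : X →ₗ[R] (Γ → R)) (hf : ∀ x γ, f x γ ∈ J) :
    f.lTensor (R ⧸ J) = 0 := by
  classical
  refine TensorProduct.ext' fun a x => ?_
  rw [LinearMap.lTensor_tmul, LinearMap.zero_apply, pi_eq_sum_univ' (f x), TensorProduct.tmul_sum]
  refine Finset.sum_eq_zero fun γ _ => ?_
  obtain ⟨r, rfl⟩ := Ideal.Quotient.mk_surjective a
  rw [← TensorProduct.smul_tmul, ← Ideal.Quotient.mk_eq_mk, ← Submodule.Quotient.mk_smul,
    (Submodule.Quotient.mk_eq_zero J).2 (by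
      rw [smul_eq_mul]; exact J.mul_mem_right _ (hf x γ)), TensorProduct.zero_tmul]

/-- `Tor^R(R ⧸ J, R ⧸ J)` from a minimal free resolution. -/
lemma nonempty_torResidue_equiv {J : Ideal R} {Γ : ℕ → Type} [∀ j, Fintype (Γ j)]
    (d : ∀ j, (Γ (j + 1) → R) →ₗ[R] (Γ j → R))
    (hdd : ∀ j x, d j (d (j + 1) x) = 0) (hex : ∀ j x, d j x = 0 → ∃ y, d (j + 1) y = x)
    (ε : (Γ 0 → R) →ₗ[R] R ⧸ J) (hε : Function.Surjective ε) (hεd : ∀ x, ε (d 0 x) = 0)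
    (hεex : ∀ x, ε x = 0 → ∃ y, d 0 y = x) (hJ : ∀ j x γ, d j x γ ∈ J) (i : ℕ) :
    Nonempty (TorResidue R J i ≃ₗ[R] (Γ i → R ⧸ J)) := by
  classical
  let F := (MonoidalCategory.tensoringLeft (ModuleCat.{0} R)).obj (ModuleCat.of R (R ⧸ J))
  let K := (F.mapHomologicalComplex (ComplexShape.down ℕ)).obj
    (moduleComplex (X := fun j => Γ j → R) d hdd)
  have h0 : ∀ a b, K.d a b = 0 := by
    intro a b
    by_cases hab : b + 1 = a
    · subst hab
      change F.map ((moduleComplex (X := fun j => Γ j → R) d hdd).d (b + 1) b) = 0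
      rw [moduleComplex_d]
      ext : 1
      exact lTensor_eq_zero_of_mem (d b) (hJ b)
    · exact K.shape _ _ hab
  let e : TorResidue R J i ≅ ModuleCat.of R (TensorProduct R (R ⧸ J) (Γ i → R)) :=
    (moduleResolution (X := fun j => Γ j → R) d hdd hex ε hε hεd hεex).isoLeftDerivedObj F i ≪≫
      ((K.iCyclesIso i _ rfl (h0 _ _)).symm ≪≫ K.isoHomologyπ _ i rfl (h0 _ _)).symm
  exact ⟨e.toLinearEquiv ≪≫ₗ TensorProduct.piScalarRight R R (R ⧸ J) (Γ i)⟩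

end TorComputation

section GradedResolution

variable {A Γ : Type} [CommRing A]

/-- The component of degree `j` of a family indexed by a graded set. -/
def degPart (deg : Γ → ℕ) (j : ℕ) (f : Γ → A) : Γ → A :=
  fun γ => if deg γ = j then f γ else 0

/-- A graded operator on families indexed by a graded set, whose reduction modulo `I` is a
minimal free resolution of `A ⧸ 𝔪`. -/
structure IsGradedResolution (deg : Γ → ℕ) (D : (Γ → A) →ₗ[A] (Γ → A)) (I 𝔪 : Ideal A)
    (γ₀ : Γ) : Prop where
  le : I ≤ 𝔪
  sq_mem : ∀ f γ, D (D f) γ ∈ I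
  degPart_map : ∀ j f, degPart deg j (D f) = D (degPart deg (j + 1) f)
  exact : ∀ j f, (∀ γ, deg γ ≠ j → f γ = 0) → (∀ γ, D f γ ∈ I) →
    ∃ g, ∀ γ, γ ≠ γ₀ → f γ - D g γ ∈ I
  deg_eq_zero : ∀ γ, deg γ = 0 ↔ γ = γ₀
  map_mem : ∀ f γ, D f γ ∈ 𝔪
  lift : ∀ c ∈ 𝔪, ∃ f, D f γ₀ = c

namespace IsGradedResolution

variable {deg : Γ → ℕ} {D : (Γ → A) →ₗ[A] (Γ → A)}
  {I 𝔪 : Ideal A} {γ₀ : Γ}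

lemma exists_lift (j : ℕ) (x : {γ // deg γ = j} → A ⧸ I) :
    ∃ f : Γ → A, (∀ γ, deg γ ≠ j → f γ = 0) ∧ x = fun γ => Ideal.Quotient.mk I (f γ.1) := by
  choose g hg using fun γ => Ideal.Quotient.mk_surjective (x γ)
  refine ⟨fun γ => if h : deg γ = j then g ⟨γ, h⟩ else 0, fun γ hγ => dif_neg hγ, ?_⟩
  ext γ
  simp only [dif_pos γ.2, Subtype.coe_eta, hg]

lemma degPart_eq_self {j : ℕ} {f : Γ → A} (hf : ∀ γ, deg γ ≠ j → f γ = 0) :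
    degPart deg j f = f := by
  ext γ
  rw [degPart]
  split_ifs with hγ
  · rfl
  · exact (hf γ hγ).symm

lemma mk_mem_map_iff (hI : I ≤ 𝔪) (c : A) :
    Ideal.Quotient.mk I c ∈ 𝔪.map (Ideal.Quotient.mk I) ↔ c ∈ 𝔪 := by
  rw [Ideal.mem_quotient_iff_mem_sup, sup_eq_left.2 hI]

variable [∀ j, Fintype {γ // deg γ = j}]

open Classical in
/-- The differentials modulo `I`. -/
noncomputable def diff (deg : Γ → ℕ) [∀ j, Fintype {γ // deg γ = j}]
    (D : (Γ → A) →ₗ[A] (Γ → A)) (I : Ideal A) (j : ℕ) :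
    ({γ // deg γ = j + 1} → A ⧸ I) →ₗ[A ⧸ I] ({γ // deg γ = j} → A ⧸ I) :=
  Matrix.mulVecLin (Matrix.of fun γ' γ => Ideal.Quotient.mk I (D (Pi.single γ.1 1) γ'.1))

lemma diff_mk (h : IsGradedResolution deg D I 𝔪 γ₀) (j : ℕ) (f : Γ → A) :
    diff deg D I j (fun γ => Ideal.Quotient.mk I (f γ.1)) =
      fun γ => Ideal.Quotient.mk I (D f γ.1) := by
  classical
  ext γ'
  have h1 : D f γ'.1 = degPart deg j (D f) γ'.1 := (if_pos γ'.2).symm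
  have h2 : degPart deg (j + 1) f =
      ∑ γ : {γ // deg γ = j + 1}, f γ.1 • (Pi.single γ.1 1 : Γ → A) := by
    ext γ
    rw [degPart, Finset.sum_apply]
    simp only [Pi.smul_apply, Pi.single_apply, smul_eq_mul, mul_ite, mul_one, mul_zero]
    split_ifs with hγ
    · rw [Finset.sum_eq_single ⟨γ, hγ⟩]
      · simp
      · intro b _ hb
        rw [if_neg fun e => hb (Subtype.ext e.symm)]
      · simp
    · refine (Finset.sum_eq_zero fun b _ => if_neg fun e => hγ ?_).symm
      rw [e, b.2]
  rw [h1, h.degPart_map, h2, map_sum, Finset.sum_apply, map_sum, diff, Matrix.mulVecLin_apply,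
    Matrix.mulVec, dotProduct]
  refine Finset.sum_congr rfl fun γ _ => ?_
  rw [map_smul, Pi.smul_apply, smul_eq_mul, map_mul, Matrix.of_apply, mul_comm]

/-- `Tor` of the residue ring, computed from the graded resolution. -/
theorem nonempty_torResidue_equiv (h : IsGradedResolution deg D I 𝔪 γ₀) (i : ℕ) :
    Nonempty (TorResidue (A ⧸ I) (𝔪.map (Ideal.Quotient.mk I)) i ≃ₗ[A ⧸ I]
      ({γ // deg γ = i} → (A ⧸ I) ⧸ 𝔪.map (Ideal.Quotient.mk I))) := by
  have h0 : deg γ₀ = 0 := (h.deg_eq_zero γ₀).2 rfl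
  have hsingle : ∀ γ : {γ // deg γ = 0}, γ = ⟨γ₀, h0⟩ := fun γ =>
    Subtype.ext ((h.deg_eq_zero γ).1 γ.2)
  refine _root_.nonempty_torResidue_equiv (Γ := fun j => {γ // deg γ = j}) (diff deg D I) ?_ ?_
    ((𝔪.map (Ideal.Quotient.mk I)).mkQ ∘ₗ LinearMap.proj ⟨γ₀, h0⟩) ?_ ?_ ?_ ?_ i
  · intro j x
    obtain ⟨f, -, rfl⟩ := exists_lift (j + 1 + 1) x
    rw [h.diff_mk, h.diff_mk]
    ext γ
    exact Ideal.Quotient.eq_zero_iff_mem.2 (h.sq_mem f γ)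
  · intro j x hx
    obtain ⟨f, hf, rfl⟩ := exists_lift (j + 1) x
    rw [h.diff_mk] at hx
    obtain ⟨g, hg⟩ := h.exact (j + 1) f hf (fun γ => by
      by_cases hγ : deg γ = j
      · exact Ideal.Quotient.eq_zero_iff_mem.1 (congrFun hx ⟨γ, hγ⟩)
      · rw [← degPart_eq_self hf, ← h.degPart_map, degPart, if_neg hγ]
        exact I.zero_mem)
    refine ⟨fun γ => Ideal.Quotient.mk I (g γ.1), ?_⟩
    rw [h.diff_mk]
    ext γ
    refine (Ideal.Quotient.eq.2 (hg γ fun e => ?_)).symm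
    have := γ.2
    rw [e, h0] at this
    omega
  · intro z
    obtain ⟨r, rfl⟩ := Ideal.Quotient.mk_surjective z
    exact ⟨fun _ => r, rfl⟩
  · intro x
    obtain ⟨f, -, rfl⟩ := exists_lift (0 + 1) x
    rw [h.diff_mk]
    exact (Submodule.Quotient.mk_eq_zero _).2 ((mk_mem_map_iff h.le _).2 (h.map_mem f γ₀))
  · intro x hx
    obtain ⟨f, -, rfl⟩ := exists_lift 0 x
    have h1 := (Submodule.Quotient.mk_eq_zero _).1 hx
    obtain ⟨g, hg⟩ := h.lift _ ((mk_mem_map_iff h.le _).1 h1)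
    refine ⟨fun γ => Ideal.Quotient.mk I (g γ.1), ?_⟩
    rw [h.diff_mk]
    ext γ
    rw [hsingle γ, hg]
  · intro j x γ
    obtain ⟨f, -, rfl⟩ := exists_lift (j + 1) x
    rw [h.diff_mk]
    exact Ideal.mem_map_of_mem _ (h.map_mem f γ)

end IsGradedResolution

end GradedResolution

section GolodCoordinates

variable {A K σ β : Type} [CommRing A] [AddCommGroup K] [Module A K]

/-- The projection to the homogeneous part of degree `i` with respect to a weighted basis. -/
noncomputable def degProj (B : Module.Basis β A K) (wt : β → ℕ) (i : ℤ) : K →ₗ[A] K :=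
  B.constr A fun b => if (wt b : ℤ) = i then B b else 0

lemma repr_degProj (B : Module.Basis β A K) (wt : β → ℕ) (i : ℤ) (x : K) (b : β) :
    B.repr (degProj B wt i x) b = if (wt b : ℤ) = i then B.repr x b else 0 := by
  classical
  have : B.coord b ∘ₗ degProj B wt i = (if (wt b : ℤ) = i then (1 : A) else 0) • B.coord b := by
    refine B.ext fun b' => ?_
    simp only [degProj, LinearMap.comp_apply, Module.Basis.constr_basis, LinearMap.smul_apply,
      Module.Basis.coord_apply]
    by_cases hb : b' = b
    · subst hb
      split_ifs <;> simp
    · split_ifs <;> simp [hb]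
  have := LinearMap.congr_fun this x
  simp only [LinearMap.comp_apply, LinearMap.smul_apply, Module.Basis.coord_apply, smul_eq_mul,
    ite_mul, one_mul, zero_mul] at this
  exact this

lemma degProj_map (B : Module.Basis β A K) (wt : β → ℕ) (f : K →ₗ[A] K) (δ : ℤ)
    (hf : ∀ b b', B.repr (f (B b)) b' ≠ 0 → (wt b' : ℤ) = wt b + δ) (i : ℤ) (x : K) :
    degProj B wt (i + δ) (f x) = f (degProj B wt i x) := by
  suffices degProj B wt (i + δ) ∘ₗ f = f ∘ₗ degProj B wt i from LinearMap.congr_fun this x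
  refine B.ext fun b => B.repr.injective (Finsupp.ext fun b' => ?_)
  rw [LinearMap.comp_apply, LinearMap.comp_apply, repr_degProj, degProj,
    Module.Basis.constr_basis]
  by_cases h : B.repr (f (B b)) b' = 0
  · split_ifs <;> simp [h]
  · have := hf b b' h
    split_ifs with h1 h2 h2
    · rfl
    · omega
    · omega
    · simp

/-- The coordinates of a family of elements. -/
noncomputable def toCoord (B : Module.Basis β A K) : (List σ → K) →ₗ[A] (List σ × β → A) :=
  LinearMap.pi fun γ => B.coord γ.2 ∘ₗ LinearMap.proj γ.1

/-- The family with the given coordinates. -/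
noncomputable def ofCoord [Fintype β] (B : Module.Basis β A K) :
    (List σ × β → A) →ₗ[A] (List σ → K) :=
  LinearMap.pi fun l => B.equivFun.symm.toLinearMap ∘ₗ LinearMap.funLeft A A fun b => (l, b)

lemma toCoord_apply (B : Module.Basis β A K) (f : List σ → K) (l : List σ) (b : β) :
    toCoord B f (l, b) = B.repr (f l) b := rfl

lemma repr_ofCoord [Fintype β] (B : Module.Basis β A K) (F : List σ × β → A) (l : List σ) (b : β) :
    B.repr (ofCoord B F l) b = F (l, b) := by
  have := congrFun (B.equivFun.apply_symm_apply fun b => F (l, b)) b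
  rwa [B.equivFun_apply] at this

lemma ofCoord_toCoord [Fintype β] (B : Module.Basis β A K) (f : List σ → K) :
    ofCoord B (toCoord B f) = f := by
  ext l
  refine B.repr.injective (Finsupp.ext fun b => ?_)
  rw [repr_ofCoord, toCoord_apply]

/-- The degree of a basis element of the iterated mapping cone. -/
def wordDeg (s : σ → ℕ) (wt : β → ℕ) (γ : List σ × β) : ℕ :=
  wt γ.2 + (γ.1.map fun v => s v + 1).sum

lemma length_le_wordDeg (s : σ → ℕ) (wt : β → ℕ) (l : List σ) (b : β) :
    l.length ≤ wordDeg s wt (l, b) := by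
  refine le_trans ?_ (Nat.le_add_left _ _)
  dsimp only
  induction l with
  | nil => simp
  | cons v l ih =>
    rw [List.length_cons, List.map_cons, List.sum_cons]
    omega

lemma ofCoord_degPart [Fintype β] (B : Module.Basis β A K) (s : σ → ℕ) (wt : β → ℕ) (j : ℕ)
    (F : List σ × β → A) (l : List σ) :
    ofCoord B (degPart (wordDeg s wt) j F) l =
      degProj B wt (j - (l.map fun v => s v + 1).sum) (ofCoord B F l) := by
  refine B.repr.injective (Finsupp.ext fun b => ?_)
  rw [repr_ofCoord, repr_degProj, repr_ofCoord, degPart, wordDeg]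
  congr 1
  rw [eq_iff_iff]
  dsimp only
  omega

/-- The iterated mapping cone in coordinates. -/
lemma IsGolodDatum.isGradedResolution [Fintype σ] [Fintype β] {I 𝔪 : Ideal A} {d : K →ₗ[A] K}
    {ψ : σ → K →ₗ[A] K} (B : Module.Basis β A K) {b₀ : β}
    (h : IsGolodDatum d (I • ⊤) 𝔪 (B b₀) ψ) (hI : I ≤ 𝔪) (s : σ → ℕ) (wt : β → ℕ)
    (hwt : ∀ b, wt b = 0 ↔ b = b₀)
    (hd : ∀ i x, degProj B wt (i + -1) (d x) = d (degProj B wt i x))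
    (hψ : ∀ v i x, degProj B wt (i + s v) (ψ v x) = ψ v (degProj B wt i x))
    (hdm : ∀ x, d x ∈ 𝔪 • (⊤ : Submodule A K)) (hψm : ∀ v x, ψ v x ∈ 𝔪 • (⊤ : Submodule A K)) :
    IsGradedResolution (wordDeg s wt) (toCoord B ∘ₗ golodD d ψ ∘ₗ ofCoord B) I 𝔪 ([], b₀) := by
  classical
  constructor
  · exact hI
  · rintro F ⟨l, b⟩
    simp only [LinearMap.comp_apply, ofCoord_toCoord, toCoord_apply]
    exact (mem_smul_top_iff_repr B).1 (h.golodD_golodD_mem _ l) b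
  · intro j F
    have key : ofCoord B (degPart (wordDeg s wt) j (toCoord B (golodD d ψ (ofCoord B F)))) =
        golodD d ψ (ofCoord B (degPart (wordDeg s wt) (j + 1) F)) := by
      ext l
      rw [ofCoord_degPart, ofCoord_toCoord, golodD_apply, golodD_apply, map_add, map_sum,
        ofCoord_degPart, ← hd]
      congr 1
      · congr 2
        push_cast
        ring
      · refine Finset.sum_congr rfl fun v _ => ?_
        rw [ofCoord_degPart, ← hψ, List.map_cons, List.sum_cons]
        congr 2
        push_cast
        ring
    ext ⟨l, b⟩
    rw [← repr_ofCoord B (degPart _ j _)]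
    exact congrArg (fun x => B.repr (x l) b) key
  · intro j F hF hD
    obtain ⟨g, c, h1, h2⟩ := h.exists_boundary j (ofCoord B F) (fun l hl => by
        refine (mem_smul_top_iff_repr B).2 fun b => ?_
        rw [repr_ofCoord, hF]
        · exact I.zero_mem
        · exact (lt_of_lt_of_le hl (length_le_wordDeg s wt l b)).ne')
      (fun l => (mem_smul_top_iff_repr B).2 fun b => hD (l, b))
    refine ⟨toCoord B g, ?_⟩
    rintro ⟨l, b⟩ hne
    simp only [LinearMap.comp_apply, ofCoord_toCoord, toCoord_apply]
    by_cases hl : l = []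
    · subst hl
      have := (mem_smul_top_iff_repr B).1 h2 b
      have hb : b₀ ≠ b := fun e => hne (by rw [e])
      simpa [repr_ofCoord, Finsupp.single_apply, hb] using this
    · have := (mem_smul_top_iff_repr B).1 (h1 l hl) b
      simpa [repr_ofCoord] using this
  · rintro ⟨l, b⟩
    rw [Prod.mk.injEq, ← hwt, wordDeg]
    cases l with
    | nil => simp
    | cons v l => simp
  · rintro F ⟨l, b⟩
    simp only [LinearMap.comp_apply, toCoord_apply, golodD_apply]
    exact (mem_smul_top_iff_repr B).1 (add_mem (hdm _) (Submodule.sum_mem _ fun v _ => hψm v _)) b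
  · intro c hc
    obtain ⟨y, hy⟩ := h.lift c hc
    refine ⟨toCoord B (Pi.single [] y), ?_⟩
    simp only [LinearMap.comp_apply, ofCoord_toCoord, toCoord_apply, golodD_apply]
    simp [hy]

end GolodCoordinates

section ExteriorGrading

variable {A : Type} [CommRing A] {M : Type} [AddCommGroup M] [Module A M]

lemma koszulD_eq_zero_of_mem_pow_zero (φ : Module.Dual A M) {x : ExteriorAlgebra A M}
    (hx : x ∈ LinearMap.range (ExteriorAlgebra.ι A : M →ₗ[A] _) ^ 0) : koszulD φ x = 0 := by
  obtain ⟨c, rfl⟩ := Submodule.mem_one.1 hx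
  exact koszulD_algebraMap φ c

lemma koszulD_mem_pow (φ : Module.Dual A M) (i : ℕ) :
    ∀ x ∈ LinearMap.range (ExteriorAlgebra.ι A : M →ₗ[A] _) ^ (i + 1),
      koszulD φ x ∈ LinearMap.range (ExteriorAlgebra.ι A : M →ₗ[A] _) ^ i := by
  induction i with
  | zero =>
    intro x hx
    rw [zero_add, pow_one] at hx
    obtain ⟨v, rfl⟩ := hx
    rw [← mul_one (ExteriorAlgebra.ι A v), koszulD_ι_mul, koszulD_one, mul_zero, sub_zero]
    exact Submodule.smul_mem _ _ (Submodule.one_le.1 le_rfl)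
  | succ i ih =>
    intro x hx
    rw [pow_succ'] at hx
    induction hx using Submodule.mul_induction_on' with
    | mem_mul_mem v hv b hb =>
      obtain ⟨v, rfl⟩ := hv
      rw [koszulD_ι_mul]
      refine sub_mem (Submodule.smul_mem _ _ hb) ?_
      rw [pow_succ']
      exact Submodule.mul_mem_mul ⟨v, rfl⟩ (ih b hb)
    | add x _ y _ hx hy =>
      rw [map_add]
      exact add_mem hx hy

variable {β : Type} [LinearOrder β] (b : Module.Basis β A M)

lemma exteriorBasis_mem (T : Finset β) :
    b.ExteriorAlgebra T ∈ LinearMap.range (ExteriorAlgebra.ι A : M →ₗ[A] _) ^ T.card := by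
  rw [← Set.powersetCard.val_ofCard (s := T) rfl, ExteriorAlgebra.basis_eq_coe_basis]
  exact Subtype.coe_prop _

lemma card_eq_of_repr_ne_zero {i : ℕ} {x : ExteriorAlgebra A M}
    (hx : x ∈ LinearMap.range (ExteriorAlgebra.ι A : M →ₗ[A] _) ^ i) {T : Finset β}
    (hT : b.ExteriorAlgebra.repr x T ≠ 0) : T.card = i := by
  have h : x ∈ Submodule.span A (b.ExteriorAlgebra '' {T | T.card = i}) := by
    have h1 := (b.exteriorPower i).mem_span ⟨x, hx⟩
    have h2 := Submodule.mem_map_of_mem (f := Submodule.subtype _) h1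
    rw [Submodule.map_span] at h2
    refine Submodule.span_mono ?_ h2
    rintro _ ⟨_, ⟨s, rfl⟩, rfl⟩
    exact ⟨s.1, s.2, ExteriorAlgebra.basis_eq_coe_basis b s⟩
  exact (Module.Basis.mem_span_image _).1 h (Finsupp.mem_support_iff.2 hT)

lemma exteriorBasis_empty : b.ExteriorAlgebra ∅ = 1 := by
  rw [ExteriorAlgebra.basis_apply_ofCard b (n := 0) Finset.card_empty]
  simp [ExteriorAlgebra.ιMulti_family]

end ExteriorGrading

section TriviallyGolod

variable {k : Type} [Field k] {n t : ℕ}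

lemma extProd_mem_pow (p : Fin t → Fin n) (l : List (Fin t)) :
    extProd k p l ∈ LinearMap.range (ExteriorAlgebra.ι (MvPolynomial (Fin n) k) :
      (Fin n → MvPolynomial (Fin n) k) →ₗ[_] _) ^ l.length := by
  induction l with
  | nil => exact Submodule.one_le.1 le_rfl
  | cons j l ih =>
    rw [extProd, List.map_cons, List.prod_cons, List.length_cons, pow_succ']
    exact Submodule.mul_mem_mul ⟨_, rfl⟩ ih

lemma golodψ_mem_pow (p : Fin t → Fin n)
    (c : {S : Finset (Fin t) // S.Nonempty} → MvPolynomial (Fin n) k)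
    (y : Fin n → MvPolynomial (Fin n) k) (S : {S : Finset (Fin t) // S.Nonempty}) {i : ℕ}
    {a : ExteriorAlgebra (MvPolynomial (Fin n) k) (Fin n → MvPolynomial (Fin n) k)}
    (ha : a ∈ LinearMap.range (ExteriorAlgebra.ι (MvPolynomial (Fin n) k) :
      (Fin n → MvPolynomial (Fin n) k) →ₗ[_] _) ^ i) :
    golodψ p c y S a ∈ LinearMap.range (ExteriorAlgebra.ι (MvPolynomial (Fin n) k) :
      (Fin n → MvPolynomial (Fin n) k) →ₗ[_] _) ^ (i + S.1.card) := by
  obtain ⟨s, hs⟩ := Nat.exists_eq_succ_of_ne_zero (Finset.card_pos.2 S.2).ne'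
  rw [golodψ_apply, golodCycle, hs, show i + (s + 1) = 1 + (i + s) by omega, pow_add, pow_one,
    pow_add]
  refine Submodule.mul_mem_mul ⟨_, rfl⟩ (Submodule.mul_mem_mul ha (Submodule.smul_mem _ _
    (koszulD_mem_pow _ _ _ ?_)))
  have := extProd_mem_pow (k := k) p (S.1.sort (· ≤ ·))
  rwa [Finset.length_sort, hs] at this

/-- The iterated mapping cone of a trivially Golod monomial ring gives a graded resolution. -/
lemma isGradedResolution_golod {m : Fin t → (Fin n →₀ ℕ)} {p : Fin t → Fin n}
    (hp : IsPrivate m p Finset.univ)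
    {c : {S : Finset (Fin t) // S.Nonempty} → MvPolynomial (Fin n) k}
    {y : Fin n → MvPolynomial (Fin n) k}
    (hc : ∀ S, varFun k n y * c S = monomial (cycExp m p S) (1 : k))
    (hI : monIdeal k m Finset.univ ≤ LinearMap.range (varFun k n)) :
    ∃ D, IsGradedResolution (wordDeg (fun S : {S : Finset (Fin t) // S.Nonempty} => S.1.card)
      (Finset.card : Finset (Fin n) → ℕ)) D (monIdeal k m Finset.univ)
      (LinearMap.range (varFun k n)) ([], ∅) := by
  let B := (Pi.basisFun (MvPolynomial (Fin n) k) (Fin n)).ExteriorAlgebra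
  have h := isGolodDatum hp hc
  rw [← exteriorBasis_empty (Pi.basisFun (MvPolynomial (Fin n) k) (Fin n))] at h
  refine ⟨_, h.isGradedResolution B hI _ _ (fun T => Finset.card_eq_zero) ?_ ?_
    koszulD_varFun_mem (golodψ_mem p c y)⟩
  · refine degProj_map B _ _ _ fun T T' hT => ?_
    have hB := exteriorBasis_mem (Pi.basisFun (MvPolynomial (Fin n) k) (Fin n)) T
    rcases hT0 : T.card with _ | i
    · rw [hT0] at hB
      rw [koszulD_eq_zero_of_mem_pow_zero _ hB, map_zero] at hT
      exact absurd rfl hT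
    · rw [hT0] at hB
      rw [card_eq_of_repr_ne_zero _ (koszulD_mem_pow _ _ _ hB) hT]
      push_cast
      ring
  · intro S
    refine degProj_map B _ _ _ fun T T' hT => ?_
    have hB := exteriorBasis_mem (Pi.basisFun (MvPolynomial (Fin n) k) (Fin n)) T
    rw [card_eq_of_repr_ne_zero _ (golodψ_mem_pow p c y S hB) hT]
    push_cast
    ring

end TriviallyGolod

section ResidueField

variable {k : Type} [Field k]

lemma finite_and_finrank_torVS {R : Type} [CommRing R] [Algebra k R] {J : Ideal R}
    (hJ : Module.finrank k (R ⧸ J) = 1) {i : ℕ} {Γ : Type} [Fintype Γ]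
    (e : TorResidue R J i ≃ₗ[R] (Γ → R ⧸ J)) :
    Module.Finite k (TorVS k R J i) ∧ Module.finrank k (TorVS k R J i) = Fintype.card Γ := by
  have : Module.Finite k (R ⧸ J) := Module.finite_of_finrank_pos (by omega)
  let e' : TorVS k R J i ≃ₗ[k] (Γ → R ⧸ J) :=
    { e.toAddEquiv with
      map_smul' := fun c x => by
        refine (e.map_smul (algebraMap k R c) x).trans ?_
        exact algebraMap_smul R c (e x) }
  refine ⟨Module.Finite.equiv e'.symm, ?_⟩
  rw [e'.finrank_eq, Module.finrank_pi_fintype, hJ]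
  simp

lemma finrank_quotient_resMax {n : ℕ} {I : Ideal (MvPolynomial (Fin n) k)}
    (hI : I ≤ Ideal.span (Set.range X)) :
    Module.finrank k ((MvPolynomial (Fin n) k ⧸ I) ⧸ resMax k n I) = 1 := by
  have hker : RingHom.ker (constantCoeff : MvPolynomial (Fin n) k →+* k) =
      Ideal.span (Set.range X) := by
    ext a
    rw [← Set.image_univ, mem_ideal_span_X_image, RingHom.mem_ker, constantCoeff_eq]
    refine ⟨fun h ξ hξ => ?_, fun h => by_contra fun h0 => ?_⟩
    · by_contra! hcon
      have : ξ = 0 := Finsupp.ext fun i => hcon i trivial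
      rw [this, mem_support_iff] at hξ
      exact hξ h
    · obtain ⟨i, -, hi⟩ := h 0 (mem_support_iff.2 h0)
      exact hi rfl
  have hmem : ∀ a : MvPolynomial (Fin n) k, Ideal.Quotient.mk I a ∈ resMax k n I ↔
      constantCoeff a = 0 := fun a => by
    rw [resMax, Ideal.mem_quotient_iff_mem_sup, sup_eq_left.2 hI, ← hker, RingHom.mem_ker]
  refine (finrank_eq_one_iff_of_nonzero' (Ideal.Quotient.mk _ (Ideal.Quotient.mk I 1)) ?_).2 ?_
  · rw [Ne, Ideal.Quotient.eq_zero_iff_mem, hmem]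
    simp
  · intro w
    obtain ⟨w, rfl⟩ := Ideal.Quotient.mk_surjective w
    obtain ⟨a, rfl⟩ := Ideal.Quotient.mk_surjective w
    refine ⟨constantCoeff a, ?_⟩
    have : constantCoeff a • Ideal.Quotient.mk (resMax k n I) (Ideal.Quotient.mk I 1) =
      Ideal.Quotient.mk (resMax k n I) (Ideal.Quotient.mk I (constantCoeff a • 1)) := rfl
    rw [this, Ideal.Quotient.eq, ← map_sub, hmem]
    simp

lemma IsGradedResolution.finite_and_finrank_torVS {A Γ : Type} [CommRing A] [Algebra k A]
    {deg : Γ → ℕ} [∀ j, Fintype {γ // deg γ = j}] {D : (Γ → A) →ₗ[A] (Γ → A)} {I 𝔪 : Ideal A}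
    {γ₀ : Γ} (h : IsGradedResolution deg D I 𝔪 γ₀)
    (hJ : Module.finrank k ((A ⧸ I) ⧸ 𝔪.map (Ideal.Quotient.mk I)) = 1) (i : ℕ) :
    Module.Finite k (TorVS k (A ⧸ I) (𝔪.map (Ideal.Quotient.mk I)) i) ∧
      Module.finrank k (TorVS k (A ⧸ I) (𝔪.map (Ideal.Quotient.mk I)) i) =
        Fintype.card {γ // deg γ = i} := by
  obtain ⟨e⟩ := h.nonempty_torResidue_equiv i
  exact _root_.finite_and_finrank_torVS hJ e

end ResidueField

section WordCounting

variable {σ β : Type} (s : σ → ℕ) (wt : β → ℕ)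

/-- A word is empty or has a first letter. -/
def wordDegEquiv (j : ℕ) : {γ : List σ × β // wordDeg s wt γ = j} ≃
    {b : β // wt b = j} ⊕ Σ v : σ, {γ : List σ × β // wordDeg s wt γ + (s v + 1) = j} where
  toFun
    | ⟨([], b), h⟩ => Sum.inl ⟨b, by simpa [wordDeg] using h⟩
    | ⟨(v :: l, b), h⟩ => Sum.inr ⟨v, (l, b), by
        simp only [wordDeg, List.map_cons, List.sum_cons] at h ⊢
        omega⟩
  invFun
    | Sum.inl ⟨b, h⟩ => ⟨([], b), by simpa [wordDeg] using h⟩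
    | Sum.inr ⟨v, (l, b), h⟩ => ⟨(v :: l, b), by
        simp only [wordDeg, List.map_cons, List.sum_cons] at h ⊢
        omega⟩
  left_inv := by
    rintro ⟨⟨_ | ⟨v, l⟩, b⟩, h⟩ <;> rfl
  right_inv := by
    rintro (⟨b, h⟩ | ⟨v, ⟨l, b⟩, h⟩) <;> rfl

lemma finite_wordDeg [Finite σ] [Finite β] (j : ℕ) :
    Finite {γ : List σ × β // wordDeg s wt γ = j} := by
  induction j using Nat.strong_induction_on with
  | _ j ih =>
    have : ∀ v, Finite {γ : List σ × β // wordDeg s wt γ + (s v + 1) = j} := fun v => by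
      by_cases hv : s v + 1 ≤ j
      · have := ih (j - (s v + 1)) (by omega)
        exact Finite.of_injective (fun γ => (⟨γ.1, by have := γ.2; omega⟩ :
          {γ : List σ × β // wordDeg s wt γ = j - (s v + 1)}))
          fun γ γ' h => Subtype.ext (congrArg (fun x => x.1) h)
      · exact Set.finite_coe_iff.2 (Set.Finite.subset Set.finite_empty
          fun γ (h : _ = j) => by omega)
    exact Finite.of_equiv _ (wordDegEquiv s wt j).symm

/-- The generating function of words with respect to the degree. -/
lemma mk_card_wordDeg [Fintype σ] [Finite β] :
    (PowerSeries.mk fun j => (Nat.card {γ : List σ × β // wordDeg s wt γ = j} : ℤ)) *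
      (1 - ∑ v, PowerSeries.X ^ (s v + 1)) =
    PowerSeries.mk fun j => (Nat.card {b : β // wt b = j} : ℤ) := by
  rw [mul_sub, mul_one, sub_eq_iff_eq_add]
  ext j
  have hfin := finite_wordDeg s wt
  have hfin' : ∀ v, Finite {γ : List σ × β // wordDeg s wt γ + (s v + 1) = j} := fun v => by
    have := Finite.of_equiv _ (wordDegEquiv s wt j)
    have := Finite.of_injective (Sum.inr : (Σ v : σ,
      {γ : List σ × β // wordDeg s wt γ + (s v + 1) = j}) → {b : β // wt b = j} ⊕ _)
      Sum.inr_injective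
    exact Finite.of_injective (fun γ => (⟨v, γ⟩ : Σ v : σ,
      {γ : List σ × β // wordDeg s wt γ + (s v + 1) = j}))
      fun γ γ' h => by simpa using h
  rw [PowerSeries.coeff_mk, Nat.card_congr (wordDegEquiv s wt j), Nat.card_sum, Nat.card_sigma,
    map_add, PowerSeries.coeff_mk, Finset.mul_sum, map_sum]
  push_cast
  congr 1
  refine Finset.sum_congr rfl fun v _ => ?_
  rw [PowerSeries.coeff_mul_X_pow', PowerSeries.coeff_mk]
  split_ifs with hv
  · congr 1
    exact Nat.card_congr (Equiv.subtypeEquivRight fun γ => by omega)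
  · have : IsEmpty {γ : List σ × β // wordDeg s wt γ + (s v + 1) = j} :=
      ⟨fun γ => by have := γ.2; omega⟩
    simp

end WordCounting

lemma mk_card_finset (n : ℕ) :
    (PowerSeries.mk fun j => (Nat.card {T : Finset (Fin n) // T.card = j} : ℤ)) =
      (1 + PowerSeries.X) ^ n := by
  have : (1 + PowerSeries.X : PowerSeries ℤ) ^ n =
      (((1 + Polynomial.X) ^ n : Polynomial ℤ) : PowerSeries ℤ) := by
    push_cast
    rfl
  ext j
  rw [this, PowerSeries.coeff_mk, Polynomial.coeff_coe, Polynomial.coeff_one_add_X_pow,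
    Nat.card_eq_fintype_card, Fintype.card_finset_len, Fintype.card_fin]

lemma sum_nonempty_X_pow (t : ℕ) :
    ∑ S : {S : Finset (Fin t) // S.Nonempty}, (PowerSeries.X : PowerSeries ℤ) ^ (S.1.card + 1) =
      ∑ i ∈ Finset.Icc 1 t, (t.choose i : ℤ) • PowerSeries.X ^ (i + 1) := by
  have h := Finset.sum_powerset_apply_card (x := (Finset.univ : Finset (Fin t)))
    (fun i => (PowerSeries.X : PowerSeries ℤ) ^ (i + 1))
  rw [sum_powerset_univ_eq (fun S => (PowerSeries.X : PowerSeries ℤ) ^ (S.card + 1)),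
    Finset.card_univ, Fintype.card_fin, Finset.range_eq_Ico, Finset.sum_eq_sum_Ico_succ_bot
      (Nat.succ_pos t)] at h
  simp only [Finset.card_empty, Nat.choose_zero_right, one_smul, zero_add] at h
  rw [add_left_cancel h]
  refine Finset.sum_congr rfl fun i _ => ?_
  simp

section TriviallyGolod

variable {k : Type} [Field k] {n t : ℕ}

lemma exists_forall_one_le_of_common_divisor (m : Fin t → (Fin n →₀ ℕ)) (j₀ : Fin t)
    (h : ∃ d : MvPolynomial (Fin n) k, ¬IsUnit d ∧ ∀ j, d ∣ monomial (m j) (1 : k)) :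
    ∃ q, ∀ j, 1 ≤ m j q := by
  obtain ⟨d, hd, hdm⟩ := h
  have hd0 : d ≠ 0 := by
    rintro rfl
    have := zero_dvd_iff.1 (hdm j₀)
    rw [monomial_eq_zero] at this
    exact one_ne_zero this
  obtain ⟨π, hπ, hπd⟩ := WfDvdMonoid.exists_irreducible_factor hd hd0
  have hπ' := hπ.prime
  have hπm := hπd.trans (hdm j₀)
  rw [monomial_eq, map_one, one_mul, Finsupp.prod] at hπm
  obtain ⟨q, -, hq⟩ := (hπ'.dvd_finsetProd_iff _).1 hπm
  have hX : Irreducible (X q : MvPolynomial (Fin n) k) := (X_prime).irreducible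
  have hassoc := (hπ.dvd_irreducible_iff_associated hX).1 (hπ'.dvd_of_dvd_pow hq)
  refine ⟨q, fun j => ?_⟩
  have := hassoc.symm.dvd.trans (hπd.trans (hdm j))
  rw [X_dvd_monomial] at this
  rcases this with h | h
  · exact absurd h one_ne_zero
  · omega

lemma MinimalTaylor.exists_lt {m : Fin t → (Fin n →₀ ℕ)} (h : MinimalTaylor m) (j : Fin t) :
    ∃ p, 0 < m j p ∧ ∀ i, i ≠ j → m i p < m j p := by
  classical
  by_contra! hcon
  refine h Finset.univ j (Finset.mem_univ j) (le_antisymm (Finset.sup_le fun i _ => ?_)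
    (Finset.sup_mono (Finset.erase_subset _ _)))
  by_cases hij : i = j
  · subst hij
    intro p
    by_cases hp : 0 < m i p
    · obtain ⟨i', hi', hle⟩ := hcon p hp
      exact hle.trans (le_finsupp_sup m (Finset.mem_erase.2 ⟨hi', Finset.mem_univ _⟩) p)
    · omega
  · exact le_finsupp_sup m (Finset.mem_erase.2 ⟨hij, Finset.mem_univ _⟩)

lemma MinimalTaylor.exists_isPrivate {m : Fin t → (Fin n →₀ ℕ)} (h : MinimalTaylor m)
    (hdeg : ∀ j, 2 ≤ (m j).sum (fun _ e => e)) {q : Fin n} (hq : ∀ j, 1 ≤ m j q) :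
    ∃ p, IsPrivate m p Finset.univ ∧
      ∀ S : Finset (Fin t), S.Nonempty → 1 ≤ cycExp m p S q := by
  classical
  obtain ⟨p, hp, hpq⟩ : ∃ p : Fin t → Fin n, IsPrivate m p Finset.univ ∧
      ∀ j, p j = q → 2 ≤ m j q := by
    by_cases ht : ∃ i j : Fin t, i ≠ j
    · choose p hp0 hp using h.exists_lt
      refine ⟨p, fun j _ => ⟨hp0 j, fun i _ hij => hp j i hij⟩, fun j hj => ?_⟩
      obtain ⟨i, hi⟩ : ∃ i, i ≠ j := by
        obtain ⟨i, i', hii'⟩ := ht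
        by_cases hij : i = j
        · exact ⟨i', fun e => hii' (hij.trans e.symm)⟩
        · exact ⟨i, hij⟩
      have h1 := hp j i hi
      rw [hj] at h1
      have := hq i
      omega
    · push Not at ht
      have key : ∀ j, ∃ p, 0 < m j p ∧ (p = q → 2 ≤ m j q) := fun j => by
        by_contra! hcon
        have h1 := (hcon q (hq j)).2
        have h2 : m j = Finsupp.single q 1 := by
          ext r
          by_cases hr : r = q
          · subst hr
            have := hq j
            simp
            omega
          · rw [Finsupp.single_eq_of_ne hr]
            by_contra h0
            exact hr (hcon r (Nat.pos_of_ne_zero h0)).1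
        have := hdeg j
        rw [h2, Finsupp.sum_single_index rfl] at this
        omega
      choose p hp0 hp using key
      exact ⟨p, fun j _ => ⟨hp0 j, fun i _ hij => absurd (ht i j) hij⟩, hp⟩
  refine ⟨p, hp, fun S hS => ?_⟩
  rw [cycExp, Finsupp.tsub_apply]
  by_cases hqS : ∃ j ∈ S, p j = q
  · obtain ⟨j, hj, rfl⟩ := hqS
    rw [(hp.mono (Finset.subset_univ S)).sum_single_apply hj]
    have := le_finsupp_sup m hj (p j)
    have := hpq j rfl
    omega
  · rw [sum_single_apply_of_notMem (by simpa using hqS)]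
    obtain ⟨j, hj⟩ := hS
    have := le_finsupp_sup m hj q
    have := hq j
    omega

lemma exists_isGradedResolution (m : Fin t → (Fin n →₀ ℕ))
    (hdeg : ∀ j, 2 ≤ (m j).sum (fun _ e => e)) (hmt : MinimalTaylor m)
    (hcommon : ∃ d : MvPolynomial (Fin n) k, ¬IsUnit d ∧ ∀ j, d ∣ monomial (m j) (1 : k)) :
    ∃ D, IsGradedResolution (wordDeg (fun S : {S : Finset (Fin t) // S.Nonempty} => S.1.card)
      (Finset.card : Finset (Fin n) → ℕ)) D (monIdeal k m Finset.univ)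
      (Ideal.span (Set.range X)) ([], ∅) := by
  classical
  rw [← range_varFun]
  have hI : monIdeal k m Finset.univ ≤ LinearMap.range (varFun k n) := by
    rw [range_varFun, monIdeal, Ideal.span_le]
    rintro _ ⟨_, ⟨j, -, rfl⟩, rfl⟩
    obtain ⟨p, hp, -⟩ := hmt.exists_lt j
    refine Ideal.mem_of_dvd _ (X_dvd_monomial.2 (Or.inr hp.ne')) (Ideal.subset_span ⟨p, rfl⟩)
  rcases isEmpty_or_nonempty (Fin t) with ht | ⟨⟨j₀⟩⟩
  · have : IsEmpty {S : Finset (Fin t) // S.Nonempty} := ⟨fun S => ht.elim S.2.choose⟩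
    exact isGradedResolution_golod (p := fun j => ht.elim j) (c := fun _ => 0) (y := 0)
      (fun j => ht.elim j) (fun S => isEmptyElim S) hI
  · obtain ⟨q, hq⟩ := exists_forall_one_le_of_common_divisor m j₀ hcommon
    obtain ⟨p, hp, hpq⟩ := hmt.exists_isPrivate hdeg hq
    refine isGradedResolution_golod hp
      (c := fun S => monomial (cycExp m p S - Finsupp.single q 1) 1) (y := Pi.single q 1)
      (fun S => ?_) hI
    rw [varFun_single, mul_one, X, monomial_mul, one_mul, add_tsub_cancel_of_le]
    exact Finsupp.single_le_iff.2 (hpq S.1 S.2)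

end TriviallyGolod

/-- If `I` is minimally generated by monomials `m_1,…,m_t` of degree at least `2` with
minimal Taylor resolution and a common non-unit factor (trivially Golod), then the Poincaré
series of `R = A/I` satisfies `P_k^R(z)·(1 - Σ_{i=1}^t C(t,i) z^{i+1}) = (1+z)^n`. -/
theorem poincare_series_trivially_golod (k : Type) [Field k] (n t : ℕ)
    (m : Fin t → (Fin n →₀ ℕ))
    (hmin : ∀ j j' : Fin t, m j ≤ m j' → j = j')
    (hdeg : ∀ j, 2 ≤ (m j).sum (fun _ e => e))
    (hmt : MinimalTaylor m)
    (hcommon : ∃ d : MvPolynomial (Fin n) k, ¬IsUnit d ∧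
        ∀ j, d ∣ monomial (m j) (1 : k))
    (I : Ideal (MvPolynomial (Fin n) k))
    (hI : I = Ideal.span (Set.range fun j => monomial (m j) (1 : k))) :
    (∀ i : ℕ, Module.Finite k (TorVS k (MvPolynomial (Fin n) k ⧸ I) (resMax k n I) i)) ∧
    (PowerSeries.mk fun i =>
        (Module.finrank k (TorVS k (MvPolynomial (Fin n) k ⧸ I) (resMax k n I) i) : ℤ)) *
      (1 - ∑ i ∈ Finset.Icc 1 t, (t.choose i : ℤ) • PowerSeries.X ^ (i + 1)) =
      (1 + PowerSeries.X) ^ n := by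
  have hI' : I = monIdeal k m Finset.univ := by
    rw [hI, monIdeal, Finset.coe_univ, Set.image_univ, ← Set.range_comp]
    rfl
  obtain ⟨D, hD⟩ := exists_isGradedResolution m hdeg hmt hcommon
  have hfin := finite_wordDeg (fun S : {S : Finset (Fin t) // S.Nonempty} => S.1.card)
    (Finset.card : Finset (Fin n) → ℕ)
  have := fun j => Fintype.ofFinite {γ // wordDeg
    (fun S : {S : Finset (Fin t) // S.Nonempty} => S.1.card)
    (Finset.card : Finset (Fin n) → ℕ) γ = j}
  rw [← hI'] at hD
  have key : ∀ i, Module.Finite k (TorVS k (MvPolynomial (Fin n) k ⧸ I) (resMax k n I) i) ∧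
      Module.finrank k (TorVS k (MvPolynomial (Fin n) k ⧸ I) (resMax k n I) i) =
        Nat.card {γ // wordDeg (fun S : {S : Finset (Fin t) // S.Nonempty} => S.1.card)
          (Finset.card : Finset (Fin n) → ℕ) γ = i} := fun i => by
    rw [Nat.card_eq_fintype_card]
    exact hD.finite_and_finrank_torVS (finrank_quotient_resMax hD.le) i
  refine ⟨fun i => (key i).1, ?_⟩
  simp only [fun i => (key i).2]
  rw [← sum_nonempty_X_pow, mk_card_wordDeg, mk_card_finset]
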